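/- Let n ≥ 2 and let h : 𝕏 → 𝕐 be an orientation-preserving homeomorphism between domains 𝕏, 𝕐 ⊂ ℝⁿ belonging to the Sobolev class W^{1,n}(𝕏, ℝⁿ). Then the inner distortion K_I(·,h) is integrable over 𝕏 if and only if the inverse map f = h⁻¹ belongs to W^{1,n}(𝕐, ℝⁿ); and in that case ∫_𝕐 |Df(y)|ⁿ dy = ∫_𝕏 K_I(x,h) dx. -/

import Mathlib

open MeasureTheory Metric Set
open scoped ENNReal NNReal

noncomputable section

abbrev Euc (n : ℕ) : Type := EuclideanSpace ℝ (Fin n)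

/-- Operator norm of an `n × n` real matrix, viewed as a linear operator on Euclidean space. -/
noncomputable def opNorm {n : ℕ} (M : Matrix (Fin n) (Fin n) ℝ) : ℝ :=
  ‖LinearMap.toContinuousLinearMap (Matrix.toEuclideanLin M)‖

/-- `g` belongs to the Sobolev class `W^{1,p}(Ω, ℝⁿ)` with weak differential `Dg`:
`g` and `Dg` are locally integrable on `Ω`, the integration-by-parts identity holds against
every smooth compactly supported test function supported in `Ω`, and `|Dg| ∈ L^p(Ω)`. -/
structure MemSobolev {n : ℕ} (p : ℝ) (Ω : Set (Euc n))
    (g : Euc n → Euc n) (Dg : Euc n → Matrix (Fin n) (Fin n) ℝ) : Prop where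
  locInt : ∀ i : Fin n, LocallyIntegrableOn (fun x => g x i) Ω volume
  locIntD : ∀ i j : Fin n, LocallyIntegrableOn (fun x => Dg x i j) Ω volume
  parts : ∀ φ : Euc n → ℝ, ContDiff ℝ ((⊤ : ℕ∞) : WithTop ℕ∞) φ → HasCompactSupport φ →
    tsupport φ ⊆ Ω → ∀ i j : Fin n,
      ∫ x in Ω, g x i * fderiv ℝ φ x (EuclideanSpace.single j 1) =
        - ∫ x in Ω, Dg x i j * φ x
  lp : IntegrableOn (fun x => opNorm (Dg x) ^ p) Ω volume

/-- `g` belongs to the local Sobolev class `W^{1,1}_loc(Ω, ℝⁿ)` with weak differential `Dg`. -/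
structure MemSobolevLoc {n : ℕ} (Ω : Set (Euc n))
    (g : Euc n → Euc n) (Dg : Euc n → Matrix (Fin n) (Fin n) ℝ) : Prop where
  locInt : ∀ i : Fin n, LocallyIntegrableOn (fun x => g x i) Ω volume
  locIntD : ∀ i j : Fin n, LocallyIntegrableOn (fun x => Dg x i j) Ω volume
  parts : ∀ φ : Euc n → ℝ, ContDiff ℝ ((⊤ : ℕ∞) : WithTop ℕ∞) φ → HasCompactSupport φ →
    tsupport φ ⊆ Ω → ∀ i j : Fin n,
      ∫ x in Ω, g x i * fderiv ℝ φ x (EuclideanSpace.single j 1) =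
        - ∫ x in Ω, Dg x i j * φ x

/-- `h : 𝕏 → 𝕐` is a homeomorphism of `𝕏` onto `𝕐` with inverse `f`. -/
structure IsHomeoOn {n : ℕ} (h f : Euc n → Euc n) (𝕏 𝕐 : Set (Euc n)) : Prop where
  mapsTo : Set.MapsTo h 𝕏 𝕐
  mapsTo_inv : Set.MapsTo f 𝕐 𝕏
  left_inv : ∀ x ∈ 𝕏, f (h x) = x
  right_inv : ∀ y ∈ 𝕐, h (f y) = y
  continuousOn : ContinuousOn h 𝕏
  continuousOn_inv : ContinuousOn f 𝕐

/-- The inner distortion function `K_I(·, h)` of a Sobolev map with weak differential `Dh`;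
`D♯h` is the cofactor (adjugate) matrix, given by Cramer's rule `(D♯h)(Dh) = (det Dh)·Id`. -/
noncomputable def innerDistortion {n : ℕ} (Dh : Euc n → Matrix (Fin n) (Fin n) ℝ)
    (x : Euc n) : ℝ≥0∞ :=
  if 0 < (Dh x).det then
    ENNReal.ofReal (opNorm ((Dh x).adjugate) ^ n / (Dh x).det ^ (n - 1))
  else if (Dh x).adjugate = 0 then 1 else ⊤

/-- The open unit ball `𝔹 ⊂ ℝⁿ`. -/
def unitBall (n : ℕ) : Set (Euc n) := Metric.ball 0 1

/-- The slit `I = {(t,0) : 0 ≤ t < 1}`, the first coordinate playing the role of `t`. -/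
def slit (n : ℕ) [NeZero n] : Set (Euc n) :=
  {p | 0 ≤ p 0 ∧ p 0 < 1 ∧ ∀ i : Fin n, i ≠ 0 → p i = 0}

/-- The model inward-cusp ball `𝔹_u = 𝔹 \ {(t,x) : t ≥ 0, |x| ≤ u(t)}`. -/
noncomputable def cuspBall (n : ℕ) [NeZero n] (u : ℝ → ℝ) : Set (Euc n) :=
  Metric.ball 0 1 \
    {p | 0 ≤ p 0 ∧ Real.sqrt (∑ i ∈ Finset.univ.erase (0 : Fin n), p i ^ 2) ≤ u (p 0)}

/-- `u` is a model cusp profile: a strictly increasing continuous surjection of `[0,∞)` onto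
itself, `C¹` on `(0,∞)`, with `u′` increasing on `(0,∞)`, `u′(s) → 0` as `s → 0⁺`, `u(1) = 1`. -/
structure IsModelCusp (u : ℝ → ℝ) : Prop where
  continuousOn : ContinuousOn u (Set.Ici 0)
  contDiffOn : ContDiffOn ℝ 1 u (Set.Ioi 0)
  strictMonoOn : StrictMonoOn u (Set.Ici 0)
  mapsTo : Set.MapsTo u (Set.Ici 0) (Set.Ici 0)
  surjOn : Set.SurjOn u (Set.Ici 0) (Set.Ici 0)
  deriv_mono : MonotoneOn (deriv u) (Set.Ioi 0)
  deriv_tendsto : Filter.Tendsto (deriv u) (nhdsWithin 0 (Set.Ioi 0)) (nhds 0)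
  one : u 1 = 1

/-- The cusp profile `u(t) = e / exp(t^{-α})` for `t > 0`, and `u(0) = 0`. -/
noncomputable def cuspFun (α : ℝ) (t : ℝ) : ℝ :=
  if 0 < t then Real.exp 1 / Real.exp (t ^ (-α)) else 0

/-- The sphere `S_t = {y ∈ 𝔹_u : |y| = t}` inside the cusp ball. -/
def cuspS (n : ℕ) [NeZero n] (u : ℝ → ℝ) (t : ℝ) : Set (Euc n) :=
  {y ∈ cuspBall n u | ‖y‖ = t}

/-- The boundary circle `C_t = {y ∈ ∂𝔹_u : |y| = t}`. -/
def cuspC (n : ℕ) [NeZero n] (u : ℝ → ℝ) (t : ℝ) : Set (Euc n) :=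
  {y ∈ frontier (cuspBall n u) | ‖y‖ = t}

/-- `S′_t = h⁻¹(S_t) ⊆ 𝔹`. -/
def cuspS' (n : ℕ) [NeZero n] (u : ℝ → ℝ) (h : Euc n → Euc n) (t : ℝ) : Set (Euc n) :=
  {x ∈ unitBall n | h x ∈ cuspS n u t}

/-- `C′_t = cl(S′_t) ∩ ∂𝔹`. -/
def cuspC' (n : ℕ) [NeZero n] (u : ℝ → ℝ) (h : Euc n → Euc n) (t : ℝ) : Set (Euc n) :=
  closure (cuspS' n u h t) ∩ Metric.sphere (0 : Euc n) 1
section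
/-! ### Piola identity -/

/-- Classical Jacobian matrix. -/
def jac {n : ℕ} (H : Euc n → Euc n) (x : Euc n) : Matrix (Fin n) (Fin n) ℝ :=
  Matrix.of fun i j => fderiv ℝ H x (EuclideanSpace.single j 1) i

theorem det_updateRow_expand {n : ℕ} (M : Matrix (Fin n) (Fin n) ℝ) (l : Fin n) (r : Fin n → ℝ) :
    (M.updateRow l r).det = ∑ m, r m * M.adjugate m l := by
  have h1 := Matrix.det_eq_sum_mul_adjugate_row (M.updateRow l r) l
  rw [h1]
  refine Finset.sum_congr rfl fun m _ => ?_
  simp [Matrix.adjugate_apply]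

theorem det_update_two_antisymm {n : ℕ} (M : Matrix (Fin n) (Fin n) ℝ) {j l : Fin n} (hjl : l ≠ j)
    (a b : Fin n → ℝ) :
    ((M.updateRow j a).updateRow l b).det = - ((M.updateRow j b).updateRow l a).det := by
  have key : ∀ c : Fin n → ℝ, ((M.updateRow j c).updateRow l c).det = 0 := by
    intro c
    apply Matrix.det_zero_of_row_eq hjl
    ext i
    simp [Matrix.updateRow_apply, hjl.symm]
  have comm : ∀ c d : Fin n → ℝ, (M.updateRow j c).updateRow l d
      = (M.updateRow l d).updateRow j c := by
    intro c d
    ext p q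
    simp only [Matrix.updateRow_apply]
    split_ifs with h1 h2 <;> simp_all
  have h0 := key (a + b)
  rw [Matrix.det_updateRow_add, comm, comm, Matrix.det_updateRow_add, Matrix.det_updateRow_add,
    ← comm, ← comm, ← comm, ← comm, key a, key b] at h0
  linarith

theorem hasFDerivAt_det {n : ℕ} {E : Type*} [NormedAddCommGroup E] [NormedSpace ℝ E]
    (A : E → Matrix (Fin n) (Fin n) ℝ) (A' : Fin n → Fin n → E →L[ℝ] ℝ) (x : E)
    (hA : ∀ i j, HasFDerivAt (fun y => A y i j) (A' i j) x) :
    HasFDerivAt (fun y => (A y).det)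
      (∑ l, ∑ m, ((A x).adjugate m l) • A' l m) x := by
  have h1 : ∀ y, (A y).det = ∑ σ : Equiv.Perm (Fin n),
      ((Equiv.Perm.sign σ : ℤ) : ℝ) * ∏ i, A y i (σ i) := by
    intro y
    rw [← Matrix.det_transpose, Matrix.det_apply']
    rfl
  have h2 : HasFDerivAt (fun y => (A y).det) (∑ σ : Equiv.Perm (Fin n),
      ((Equiv.Perm.sign σ : ℤ) : ℝ) • ∑ i, (∏ k ∈ Finset.univ.erase i, A x k (σ k)) •
        A' i (σ i)) x := by
    simp_rw [h1]
    refine HasFDerivAt.fun_sum fun σ _ => ?_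
    exact (HasFDerivAt.finsetProd fun i _ => hA i (σ i)).const_mul _
  convert! h2 using 1
  ext w
  simp only [sum_apply, smul_apply, smul_eq_mul,
    Finset.mul_sum]
  rw [Finset.sum_comm (s := (Finset.univ : Finset (Equiv.Perm (Fin n))))]
  refine Finset.sum_congr rfl fun l _ => ?_
  have := det_updateRow_expand (A x) l (fun m => A' l m w)
  simp_rw [mul_comm ((A x).adjugate _ l)]
  rw [← this, ← Matrix.det_transpose, Matrix.det_apply']
  refine Finset.sum_congr rfl fun σ _ => ?_
  congr 1
  rw [← Finset.mul_prod_erase _ _ (Finset.mem_univ l), mul_comm]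
  congr 1
  · refine Finset.prod_congr rfl fun k hk => ?_
    simp [Matrix.updateRow_apply, Finset.ne_of_mem_erase hk]
  · simp

variable {n : ℕ}

theorem jac_apply (H : Euc n → Euc n) (x : Euc n) (i j : Fin n) :
    jac H x i j = fderiv ℝ H x (EuclideanSpace.single j 1) i := rfl

theorem jac_entry_contDiff {H : Euc n → Euc n} (hH : ContDiff ℝ ((⊤ : ℕ∞) : WithTop ℕ∞) H)
    (i j : Fin n) : ContDiff ℝ ((⊤ : ℕ∞) : WithTop ℕ∞) (fun x => jac H x i j) := by
  have h1 : ContDiff ℝ ((⊤ : ℕ∞) : WithTop ℕ∞) (fderiv ℝ H) :=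
    hH.fderiv_right (by exact le_rfl)
  have h2 : ContDiff ℝ ((⊤ : ℕ∞) : WithTop ℕ∞)
      (fun x => fderiv ℝ H x (EuclideanSpace.single j 1)) :=
    h1.clm_apply contDiff_const
  exact (contDiff_piLp_apply (𝕜 := ℝ) (p := 2) (i := i)).comp h2

theorem contDiff_det {E : Type*} [NormedAddCommGroup E] [NormedSpace ℝ E]
    {A : E → Matrix (Fin n) (Fin n) ℝ}
    (hA : ∀ i j, ContDiff ℝ ((⊤ : ℕ∞) : WithTop ℕ∞) (fun y => A y i j)) :
    ContDiff ℝ ((⊤ : ℕ∞) : WithTop ℕ∞) (fun y => (A y).det) := by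
  simp_rw [Matrix.det_apply']
  refine ContDiff.sum fun σ _ => contDiff_const.mul (contDiff_prod fun i _ => hA _ _)

theorem contDiff_adjugate {E : Type*} [NormedAddCommGroup E] [NormedSpace ℝ E]
    {A : E → Matrix (Fin n) (Fin n) ℝ}
    (hA : ∀ i j, ContDiff ℝ ((⊤ : ℕ∞) : WithTop ℕ∞) (fun y => A y i j)) (k j : Fin n) :
    ContDiff ℝ ((⊤ : ℕ∞) : WithTop ℕ∞) (fun y => (A y).adjugate k j) := by
  simp_rw [Matrix.adjugate_apply]
  refine contDiff_det fun p q => ?_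
  by_cases hp : p = j
  · subst hp; simpa using contDiff_const
  · simpa [Matrix.updateRow_apply, hp] using hA p q

theorem piola {H : Euc n → Euc n} (hH : ContDiff ℝ ((⊤ : ℕ∞) : WithTop ℕ∞) H) (x : Euc n)
    (j : Fin n) :
    ∑ k, fderiv ℝ (fun y => (jac H y).adjugate k j) x (EuclideanSpace.single k 1) = 0 := by
  set S : Fin n → Fin n → Fin n → ℝ := fun l m k =>
    fderiv ℝ (fun y => jac H y l m) x (EuclideanSpace.single k 1) with hS
  have hsymm : ∀ l m k, S l m k = S l k m := by
    intro l m k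
    have hs : IsSymmSndFDerivAt ℝ H x := (hH.contDiffAt).isSymmSndFDerivAt (by
      simp only [minSmoothness_of_isRCLikeNormedField]
      exact WithTop.coe_le_coe.2 (le_top : (2 : ℕ∞) ≤ ⊤))
    have hd : DifferentiableAt ℝ (fderiv ℝ H) x :=
      ((hH.fderiv_right (m := ((⊤ : ℕ∞) : WithTop ℕ∞)) le_rfl).differentiable (by simp)) x
    have e : ∀ m k, S l m k = (fderiv ℝ (fderiv ℝ H) x (EuclideanSpace.single k 1)
        (EuclideanSpace.single m 1)) l := by
      intro m k
      have h1 : HasFDerivAt (fun y => jac H y l m)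
          ((EuclideanSpace.proj l : Euc n →L[ℝ] ℝ).comp
          ((ContinuousLinearMap.apply ℝ (Euc n) (EuclideanSpace.single m (1:ℝ))).comp
            (fderiv ℝ (fderiv ℝ H) x))) x := by
        exact (EuclideanSpace.proj l : Euc n →L[ℝ] ℝ).hasFDerivAt.comp x
          ((ContinuousLinearMap.apply ℝ (Euc n) (EuclideanSpace.single m (1:ℝ))).hasFDerivAt.comp x
            hd.hasFDerivAt)
      simp only [hS]
      rw [h1.fderiv]
      rfl
    rw [e, e, hs]
  have hdiff : ∀ l m, DifferentiableAt ℝ (fun y => jac H y l m) x := fun l m =>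
    ((jac_entry_contDiff hH l m).differentiable (by simp)) x
  have hk : ∀ k, fderiv ℝ (fun y => (jac H y).adjugate k j) x (EuclideanSpace.single k 1)
      = ∑ l, ∑ m, if l = j then 0 else S l m k *
        (((jac H x).updateRow j (Pi.single k 1)).updateRow l (Pi.single m 1)).det := by
    intro k
    simp_rw [Matrix.adjugate_apply]
    have := hasFDerivAt_det (fun y => (jac H y).updateRow j (Pi.single k 1))
      (fun l m => if l = j then 0 else fderiv ℝ (fun y => jac H y l m) x) x (by
        intro p q
        by_cases hp : p = j
        · subst hp
          simpa using hasFDerivAt_const _ _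
        · simpa [Matrix.updateRow_apply, hp] using (hdiff p q).hasFDerivAt)
    rw [this.fderiv]
    simp only [sum_apply, smul_apply, smul_eq_mul]
    refine Finset.sum_congr rfl fun l _ => Finset.sum_congr rfl fun m _ => ?_
    split_ifs with h
    · simp
    · rw [mul_comm, Matrix.adjugate_apply]
  simp_rw [hk]
  rw [Finset.sum_comm]
  refine Finset.sum_eq_zero fun l _ => ?_
  by_cases hl : l = j
  · simp [hl]
  simp only [hl, if_false]
  have h1 : ∑ k, ∑ m, S l m k *
        (((jac H x).updateRow j (Pi.single k 1)).updateRow l (Pi.single m 1)).det =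
      - ∑ k, ∑ m, S l m k *
        (((jac H x).updateRow j (Pi.single k 1)).updateRow l (Pi.single m 1)).det := by
    conv_lhs => rw [Finset.sum_comm]
    rw [← Finset.sum_neg_distrib]
    refine Finset.sum_congr rfl fun k _ => ?_
    rw [← Finset.sum_neg_distrib]
    refine Finset.sum_congr rfl fun m _ => ?_
    rw [det_update_two_antisymm _ hl, hsymm]
    ring
  linarith

/-- Null Lagrangian identity for smooth maps. -/
theorem nullLagrangian {H : Euc n → Euc n} (hH : ContDiff ℝ ((⊤ : ℕ∞) : WithTop ℕ∞) H)
    {η : Euc n → ℝ} (hη : ContDiff ℝ ((⊤ : ℕ∞) : WithTop ℕ∞) η) (hc : HasCompactSupport η)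
    (j : Fin n) :
    ∫ x, ∑ k, fderiv ℝ η x (EuclideanSpace.single k 1) * (jac H x).adjugate k j = 0 := by
  have hadj : ∀ k, ContDiff ℝ ((⊤ : ℕ∞) : WithTop ℕ∞) (fun y => (jac H y).adjugate k j) :=
    fun k => contDiff_adjugate (jac_entry_contDiff hH) k j
  have hηd : ∀ k, Continuous fun x => fderiv ℝ η x (EuclideanSpace.single k 1) := fun k =>
    (hη.continuous_fderiv (by simp)).clm_apply continuous_const
  have had : ∀ k, Continuous fun x =>
      fderiv ℝ (fun y => (jac H y).adjugate k j) x (EuclideanSpace.single k 1) := fun k =>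
    ((hadj k).continuous_fderiv (by simp)).clm_apply continuous_const
  have i1 : ∀ k, Integrable (fun x => fderiv ℝ η x (EuclideanSpace.single k 1) *
      (jac H x).adjugate k j) := fun k =>
    ((hηd k).mul (hadj k).continuous).integrable_of_hasCompactSupport
      ((hc.fderiv_apply (𝕜 := ℝ) _).mul_right)
  have i2 : ∀ k, Integrable (fun x => η x *
      fderiv ℝ (fun y => (jac H y).adjugate k j) x (EuclideanSpace.single k 1)) := fun k =>
    (hη.continuous.mul (had k)).integrable_of_hasCompactSupport hc.mul_right
  have i3 : ∀ k, Integrable (fun x => η x * (jac H x).adjugate k j) := fun k =>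
    (hη.continuous.mul (hadj k).continuous).integrable_of_hasCompactSupport hc.mul_right
  rw [integral_finsetSum _ fun k _ => i1 k]
  have : ∀ k, ∫ x, fderiv ℝ η x (EuclideanSpace.single k 1) * (jac H x).adjugate k j
      = - ∫ x, η x * fderiv ℝ (fun y => (jac H y).adjugate k j) x (EuclideanSpace.single k 1) := by
    intro k
    rw [integral_mul_fderiv_eq_neg_fderiv_mul_of_integrable (i1 k) (i2 k) (i3 k)
      (fun x _ => (hη.differentiable (by simp)) x)
      (fun x _ => ((hadj k).differentiable (by simp)) x), neg_neg]
  simp_rw [this]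
  rw [Finset.sum_neg_distrib, ← integral_finsetSum _ fun k _ => i2 k]
  simp_rw [← Finset.mul_sum, piola hH]
  simp

end

section
open Filter Topology

/-! ### Smooth degree theory -/

theorem euc_sum {n : ℕ} (v : Euc n) : v = ∑ l, v l • EuclideanSpace.single l (1 : ℝ) := by
  ext i
  simp [Finset.sum_apply, Pi.single_apply]

theorem clm_expand {n : ℕ} {F : Type*} [NormedAddCommGroup F] [NormedSpace ℝ F]
    (A : Euc n →L[ℝ] F) (v : Euc n) :
    A v = ∑ l, v l • A (EuclideanSpace.single l 1) := by
  conv_lhs => rw [euc_sum v]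
  simp

theorem det_fderiv_eq {n : ℕ} (H : Euc n → Euc n) (x : Euc n) :
    (fderiv ℝ H x).det = (jac H x).det := by
  rw [ContinuousLinearMap.det,
    ← LinearMap.det_toMatrix (EuclideanSpace.basisFun (Fin n) ℝ).toBasis]
  congr 1

theorem jac_comp {n : ℕ} {F H : Euc n → Euc n} {x : Euc n} (hF : DifferentiableAt ℝ F (H x))
    (hH : DifferentiableAt ℝ H x) : jac (F ∘ H) x = jac F (H x) * jac H x := by
  ext i j
  rw [jac_apply, fderiv_comp x hF hH, Matrix.mul_apply]
  simp only [ContinuousLinearMap.comp_apply]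
  rw [clm_expand (fderiv ℝ F (H x))]
  simp [jac_apply, mul_comm]

theorem contDiff_indicator {E F : Type*} [NormedAddCommGroup E] [NormedSpace ℝ E]
    [NormedAddCommGroup F] [NormedSpace ℝ F] {O : Set E} (hO : IsOpen O)
    {Φ : E → F} (hΦ : ContDiff ℝ (⊤ : ℕ∞) Φ) (hfr : ∀ x ∈ frontier O, Φ =ᶠ[𝓝 x] 0) :
    ContDiff ℝ (⊤ : ℕ∞) (O.indicator Φ) ∧ ∀ x, x ∉ O → (O.indicator Φ) =ᶠ[𝓝 x] 0 := by
  have h2 : ∀ x, x ∉ O → (O.indicator Φ) =ᶠ[𝓝 x] 0 := by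
    intro x hx
    by_cases hc : x ∈ closure O
    · have : x ∈ frontier O := by rw [frontier, hO.interior_eq]; exact ⟨hc, hx⟩
      filter_upwards [hfr x this] with y hy
      by_cases hyO : y ∈ O <;> simp [hyO, hy]
    · filter_upwards [isClosed_closure.isOpen_compl.mem_nhds hc] with y hy
      have : y ∉ O := fun h => hy (subset_closure h)
      simp [this]
  refine ⟨contDiff_iff_contDiffAt.2 fun x => ?_, h2⟩
  by_cases hx : x ∈ O
  · refine hΦ.contDiffAt.congr_of_eventuallyEq ?_
    filter_upwards [hO.mem_nhds hx] with y hy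
    simp [hy]
  · exact (contDiffAt_const (c := (0 : F))).congr_of_eventuallyEq (h2 x hx)

theorem comp_eventually_zero {E F G : Type*} [TopologicalSpace E] [TopologicalSpace F] [Zero G]
    {H : E → F} (hH : Continuous H) {φ : F → G} {x : E} (hx : H x ∉ tsupport φ) :
    (fun y => φ (H y)) =ᶠ[𝓝 x] 0 := by
  have := hH.continuousAt.eventually (notMem_tsupport_iff_eventuallyEq.1 hx)
  exact this

variable {n : ℕ}

theorem parts_smooth {H : Euc n → Euc n} (hH : ContDiff ℝ (⊤ : ℕ∞) H) {O : Set (Euc n)}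
    (hO : IsOpen O) (hOb : Bornology.IsBounded O)
    {φ : Euc n → ℝ} (hφ : ContDiff ℝ (⊤ : ℕ∞) φ)
    (hfr : ∀ x ∈ frontier O, H x ∉ tsupport φ) {ζ : Euc n → ℝ} (hζ : ContDiff ℝ (⊤ : ℕ∞) ζ)
    (j : Fin n) :
    ∫ x in O, (φ (H x) * ∑ k, fderiv ℝ ζ x (EuclideanSpace.single k 1) * (jac H x).adjugate k j
      + ζ x * fderiv ℝ φ (H x) (EuclideanSpace.single j 1) * (jac H x).det) = 0 := by
  set Φ : Euc n → ℝ := fun x => ζ x * φ (H x) with hΦ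
  have hΦs : ContDiff ℝ (⊤ : ℕ∞) Φ := hζ.mul (hφ.comp hH)
  have hfr' : ∀ x ∈ frontier O, Φ =ᶠ[𝓝 x] 0 := fun x hx => by
    filter_upwards [comp_eventually_zero hH.continuous (hfr x hx)] with y hy
    simp only [hΦ]; rw [hy]; simp
  obtain ⟨hs, hz⟩ := contDiff_indicator hO hΦs hfr'
  have hcs : HasCompactSupport (O.indicator Φ) :=
    HasCompactSupport.of_support_subset_isCompact hOb.isCompact_closure
      ((support_indicator_subset).trans subset_closure)
  have hN := nullLagrangian hH hs hcs j
  rw [← setIntegral_eq_integral_of_forall_compl_eq_zero (s := O)] at hN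
  rw [← hN]
  · refine setIntegral_congr_fun hO.measurableSet fun x hx => ?_
    have h1 : fderiv ℝ (O.indicator Φ) x = fderiv ℝ Φ x := by
      apply Filter.EventuallyEq.fderiv_eq
      filter_upwards [hO.mem_nhds hx] with y hy
      simp [hy]
    have hd1 : DifferentiableAt ℝ ζ x := hζ.differentiable (by simp) x
    have hd2 : DifferentiableAt ℝ φ (H x) := hφ.differentiable (by simp) _
    have hd3 : DifferentiableAt ℝ H x := hH.differentiable (by simp) x
    have h2 : ∀ v, fderiv ℝ Φ x v = ζ x * fderiv ℝ φ (H x) (fderiv ℝ H x v)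
        + φ (H x) * fderiv ℝ ζ x v := by
      intro v
      have := (hd1.hasFDerivAt.mul (hd2.hasFDerivAt.comp x hd3.hasFDerivAt)).fderiv
      have e : Φ = ζ * (φ ∘ H) := rfl
      rw [e, this]
      simp
    simp only [h1, h2, add_mul, Finset.sum_add_distrib]
    have h4 : ∑ k, ζ x * fderiv ℝ φ (H x) (fderiv ℝ H x (EuclideanSpace.single k 1)) *
        (jac H x).adjugate k j
        = ζ x * fderiv ℝ φ (H x) (EuclideanSpace.single j 1) * (jac H x).det := by
      have : ∀ k, fderiv ℝ φ (H x) (fderiv ℝ H x (EuclideanSpace.single k 1)) =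
          ∑ l, jac H x l k * fderiv ℝ φ (H x) (EuclideanSpace.single l 1) := by
        intro k
        rw [clm_expand (fderiv ℝ φ (H x))]
        rfl
      simp_rw [this, Finset.mul_sum, Finset.sum_mul]
      rw [Finset.sum_comm]
      have : ∀ l, ∑ k, ζ x * (jac H x l k * fderiv ℝ φ (H x) (EuclideanSpace.single l 1)) *
          (jac H x).adjugate k j = ζ x * fderiv ℝ φ (H x) (EuclideanSpace.single l 1) *
          ((jac H x * (jac H x).adjugate) l j) := by
        intro l
        rw [Matrix.mul_apply, Finset.mul_sum]
        exact Finset.sum_congr rfl fun k _ => by ring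
      simp_rw [this, Matrix.mul_adjugate]
      rw [Finset.sum_eq_single j]
      · simp
      · intro b _ hb
        simp [Matrix.one_apply_ne hb]
      · simp
    rw [h4, Finset.mul_sum, add_comm]
    congr 1
    exact Finset.sum_congr rfl fun k _ => by ring
  · intro x hx
    have : fderiv ℝ (O.indicator Φ) x = 0 := by
      rw [(hz x hx).fderiv_eq]; simp
    exact Finset.sum_eq_zero fun k _ => by rw [this]; simp

/-- The degree functional. -/
def degL (H : Euc n → Euc n) (O : Set (Euc n)) (g : Euc n → ℝ) : ℝ :=
  ∫ x in O, g (H x) * (jac H x).det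

theorem jac_det_continuous {H : Euc n → Euc n} (hH : ContDiff ℝ (⊤ : ℕ∞) H) :
    Continuous fun x => (jac H x).det :=
  (contDiff_det (jac_entry_contDiff hH)).continuous

theorem degL_fderiv {H : Euc n → Euc n} (hH : ContDiff ℝ (⊤ : ℕ∞) H) {O : Set (Euc n)}
    (hO : IsOpen O) (hOb : Bornology.IsBounded O)
    {φ : Euc n → ℝ} (hφ : ContDiff ℝ (⊤ : ℕ∞) φ)
    (hfr : ∀ x ∈ frontier O, H x ∉ tsupport φ) (v : Euc n) :
    degL H O (fun y => fderiv ℝ φ y v) = 0 := by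
  have h1 : ∀ j, degL H O (fun y => fderiv ℝ φ y (EuclideanSpace.single j 1)) = 0 := by
    intro j
    have := parts_smooth hH hO hOb hφ hfr (ζ := fun _ => 1) contDiff_const j
    simpa [degL] using this
  have h2 : ∀ y, fderiv ℝ φ y v = ∑ j, v j * fderiv ℝ φ y (EuclideanSpace.single j 1) :=
    fun y => clm_expand _ v
  have hintg : ∀ j, IntegrableOn (fun x => v j * fderiv ℝ φ (H x) (EuclideanSpace.single j 1) *
      (jac H x).det) O := by
    intro j
    refine IntegrableOn.mono_set (t := closure O) ?_ subset_closure
    refine ContinuousOn.integrableOn_compact hOb.isCompact_closure (Continuous.continuousOn ?_)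
    have : Continuous fun x => fderiv ℝ φ (H x) (EuclideanSpace.single j 1) :=
      ((hφ.continuous_fderiv (by simp)).comp hH.continuous).clm_apply continuous_const
    exact (continuous_const.mul this).mul (jac_det_continuous hH)
  simp only [degL] at h1 ⊢
  simp_rw [h2, Finset.sum_mul]
  rw [integral_finsetSum _ fun j _ => hintg j]
  refine Finset.sum_eq_zero fun j _ => ?_
  simp_rw [mul_assoc]
  rw [integral_const_mul, h1, mul_zero]

theorem degL_translate {H : Euc n → Euc n} (hH : ContDiff ℝ (⊤ : ℕ∞) H) {O : Set (Euc n)}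
    (hO : IsOpen O) (hOb : Bornology.IsBounded O) {p : Euc n} {ρ : ℝ}
    (hfr : ∀ x ∈ frontier O, H x ∉ ball p ρ)
    {g : Euc n → ℝ} (hg : ContDiff ℝ (⊤ : ℕ∞) g) (hgs : tsupport g ⊆ ball p (ρ / 2))
    {v : Euc n} (hv : ‖v‖ < ρ / 2) :
    degL H O (fun y => g (y - v)) = degL H O g := by
  have hgc : HasCompactSupport g := (isCompact_closedBall p (ρ/2)).of_isClosed_subset
    (isClosed_tsupport g) (hgs.trans ball_subset_closedBall)
  set w : Euc n → ℝ := fun x => (jac H x).det with hw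
  have hwc : Continuous w := jac_det_continuous hH
  set Λ : ℝ → ℝ := fun t => degL H O (fun y => g (y - t • v)) with hΛ
  have hgd : Continuous (fderiv ℝ g) := hg.continuous_fderiv (by simp)
  obtain ⟨C, hC⟩ : ∃ C, ∀ y, ‖fderiv ℝ g y‖ ≤ C :=
    (hgc.fderiv (𝕜 := ℝ)).exists_bound_of_continuous hgd
  have hder : ∀ t : ℝ, HasDerivAt Λ (∫ x in O, (fderiv ℝ g (H x - t • v) (-v)) * w x) t := by
    intro t
    refine (hasDerivAt_integral_of_dominated_loc_of_deriv_le (s := univ)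
      (F := fun t x => g (H x - t • v) * w x)
      (F' := fun t x => (fderiv ℝ g (H x - t • v) (-v)) * w x)
      (bound := fun x => C * ‖v‖ * ‖w x‖) univ_mem ?_ ?_ ?_ ?_ ?_ ?_).2
    · refine Eventually.of_forall fun s => ?_
      exact ((hg.continuous.comp (hH.continuous.sub continuous_const)).mul
        hwc).aestronglyMeasurable
    · refine IntegrableOn.mono_set (t := closure O) ?_ subset_closure
      exact ContinuousOn.integrableOn_compact hOb.isCompact_closure (Continuous.continuousOn
        ((hg.continuous.comp (hH.continuous.sub continuous_const)).mul hwc))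
    · exact (((hgd.comp (hH.continuous.sub continuous_const)).clm_apply continuous_const).mul
        hwc).aestronglyMeasurable
    · refine Eventually.of_forall fun x s _ => ?_
      rw [norm_mul]
      gcongr
      refine (ContinuousLinearMap.le_opNorm _ _).trans ?_
      rw [norm_neg]
      gcongr
      exact hC _
    · refine IntegrableOn.mono_set (t := closure O) ?_ subset_closure
      exact ContinuousOn.integrableOn_compact hOb.isCompact_closure (Continuous.continuousOn
        (continuous_const.mul hwc.norm))
    · refine Eventually.of_forall fun x s _ => ?_
      refine HasDerivAt.mul_const ?_ _
      have h1 : HasDerivAt (fun s : ℝ => H x - s • v) (-v) s := by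
        have := ((hasDerivAt_id s).smul_const v).const_sub (H x)
        simpa using this
      exact (hg.differentiable (by simp) (H x - s • v)).hasFDerivAt.comp_hasDerivAt s h1
  have hzero : ∀ t ∈ Icc (0:ℝ) 1, ∫ x in O, (fderiv ℝ g (H x - t • v) (-v)) * w x = 0 := by
    intro t ht
    have hgt : ContDiff ℝ (⊤ : ℕ∞) (fun y => g (y - t • v)) :=
      hg.comp (contDiff_id.sub contDiff_const)
    have key := degL_fderiv hH hO hOb hgt (fun x hx hmem => hfr x hx ?_) (-v)
    · rw [← key, degL]
      congr 1
      ext x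
      rw [fderiv_comp_sub (f := g)]
    · have h1 : H x - t • v ∈ tsupport g := by
        have : tsupport (fun y => g (y - t • v)) ⊆ (fun y => y - t • v) ⁻¹' tsupport g :=
          closure_minimal (fun y hy => subset_closure hy)
            ((isClosed_tsupport g).preimage (continuous_id.sub continuous_const))
        exact this hmem
      have h2 := hgs h1
      rw [mem_ball, dist_eq_norm] at h2 ⊢
      have h3 : ‖t • v‖ ≤ ‖v‖ := by
        rw [norm_smul, Real.norm_of_nonneg ht.1]
        exact mul_le_of_le_one_left (norm_nonneg _) ht.2
      calc ‖H x - p‖ = ‖(H x - t • v - p) + t • v‖ := by congr 1; abel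
        _ ≤ _ := norm_add_le _ _
        _ < ρ := by linarith
  have := constant_of_has_deriv_right_zero (f := Λ) (a := 0) (b := 1)
    (fun t _ => (hder t).continuousAt.continuousWithinAt)
    (fun t ht => by
      have := hder t
      rw [hzero t ⟨ht.1, ht.2.le⟩] at this
      exact this.hasDerivWithinAt) 1 (by simp)
  simpa [hΛ] using this

theorem degL_const {H : Euc n → Euc n} (hH : ContDiff ℝ (⊤ : ℕ∞) H) {O : Set (Euc n)}
    (hO : IsOpen O) (hOb : Bornology.IsBounded O) {p : Euc n} {ρ : ℝ} (hρ : 0 < ρ)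
    (hfr : ∀ x ∈ frontier O, H x ∉ ball p ρ) :
    ∃ c : ℝ, ∀ g : Euc n → ℝ, ContDiff ℝ (⊤ : ℕ∞) g → tsupport g ⊆ ball p (ρ / 2) →
      degL H O g = c * ∫ y, g y := by
  let b : ContDiffBump (0 : Euc n) := ⟨ρ / 8, ρ / 4, by positivity, by linarith⟩
  set ψ : Euc n → ℝ := b.normed volume with hψ
  have hψs : ContDiff ℝ (⊤ : ℕ∞) ψ := b.contDiff_normed
  have hψi : ∫ v, ψ v = 1 := b.integral_normed
  have hψt : tsupport ψ = closedBall 0 (ρ / 4) := b.tsupport_normed_eq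
  refine ⟨degL H O (fun y => ψ (y - p)), fun g hg hgs => ?_⟩
  set w : Euc n → ℝ := fun x => (jac H x).det with hw
  have hwc : Continuous w := jac_det_continuous hH
  have hgc : IsCompact (tsupport g) := (isCompact_closedBall p (ρ/2)).of_isClosed_subset
    (isClosed_tsupport g) (hgs.trans ball_subset_closedBall)
  have hψc : IsCompact (tsupport ψ) := by rw [hψt]; exact isCompact_closedBall _ _
  have fub : ∀ (K : Set (Euc n)) (hK : IsCompact K) (Φ : Euc n → Euc n → ℝ)
      (hΦ : Continuous (Function.uncurry Φ)) (hΦ0 : ∀ v, v ∉ K → ∀ x, Φ v x = 0),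
      ∫ v, ∫ x in O, Φ v x = ∫ x in O, ∫ v, Φ v x := by
    intro K hK Φ hΦ hΦ0
    have e1 : ∫ v, ∫ x in O, Φ v x = ∫ v in K, ∫ x in O, Φ v x := by
      rw [setIntegral_eq_integral_of_forall_compl_eq_zero]
      intro v hv
      simp [hΦ0 v hv]
    have e2 : ∀ x, ∫ v, Φ v x = ∫ v in K, Φ v x := by
      intro x
      rw [setIntegral_eq_integral_of_forall_compl_eq_zero]
      intro v hv
      exact hΦ0 v hv x
    simp_rw [e1, e2]
    refine integral_integral_swap ?_
    rw [Measure.prod_restrict]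
    refine IntegrableOn.mono_set (t := K ×ˢ closure O) ?_ (prod_mono le_rfl subset_closure)
    exact hΦ.continuousOn.integrableOn_compact (hK.prod hOb.isCompact_closure)
  have c1 : ∫ v, ψ v * degL H O (fun y => g (y - v)) = degL H O g := by
    have : ∀ v, ψ v * degL H O (fun y => g (y - v)) = ψ v * degL H O g := by
      intro v
      by_cases hv : v ∈ tsupport ψ
      · rw [degL_translate hH hO hOb hfr hg hgs]
        rw [hψt, mem_closedBall_zero_iff] at hv
        linarith
      · rw [image_eq_zero_of_notMem_tsupport hv]; simp
    simp_rw [this]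
    rw [integral_mul_const, hψi, one_mul]
  have hψp : tsupport (fun y => ψ (y - p)) ⊆ ball p (ρ / 2) := by
    have : tsupport (fun y => ψ (y - p)) ⊆ (fun y => y - p) ⁻¹' tsupport ψ :=
      closure_minimal (fun y hy => subset_closure hy)
        ((isClosed_tsupport ψ).preimage (continuous_id.sub continuous_const))
    intro y hy
    have := this hy
    rw [hψt] at this
    simp only [mem_preimage, mem_closedBall_zero_iff] at this
    rw [mem_ball, dist_eq_norm]
    linarith
  have c2 : ∫ u, g u * degL H O (fun y => ψ (y - u)) =
      degL H O (fun y => ψ (y - p)) * ∫ y, g y := by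
    have : ∀ u, g u * degL H O (fun y => ψ (y - u)) =
        g u * degL H O (fun y => ψ (y - p)) := by
      intro u
      by_cases hu : u ∈ tsupport g
      · have h1 := hgs hu
        rw [mem_ball, dist_eq_norm] at h1
        have := degL_translate hH hO hOb hfr
          (g := fun y => ψ (y - p)) (hψs.comp (contDiff_id.sub contDiff_const)) hψp h1
        have e : ∀ y : Euc n, y - (u - p) - p = y - u := fun y => by abel
        simp only [e] at this
        rw [this]
      · rw [image_eq_zero_of_notMem_tsupport hu]; simp
    simp_rw [this]
    rw [integral_mul_const, mul_comm]
  rw [← c1, ← c2]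
  simp only [degL, ← integral_const_mul]
  rw [fub _ hψc (fun v x => ψ v * (g (H x - v) * w x)), fub _ hgc (fun v x => g v * (ψ (H x - v) * w x))]
  · congr 1
    ext x
    rw [← integral_sub_left_eq_self (fun v => g v * (ψ (H x - v) * w x)) volume (H x)]
    congr 1
    ext v
    rw [sub_sub_cancel]; ring
  · have := hψs.continuous; have := hg.continuous; have := hH.continuous
    simp only [Function.uncurry_def]
    fun_prop
  · intro v hv x; rw [image_eq_zero_of_notMem_tsupport hv]; simp
  · have := hψs.continuous; have := hg.continuous; have := hH.continuous
    simp only [Function.uncurry_def]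
    fun_prop
  · intro v hv x; rw [image_eq_zero_of_notMem_tsupport hv]; simp

end

section
open Filter Topology

variable {n : ℕ}

/-- local diffeomorphism data at a regular point -/
theorem local_inj {H : Euc n → Euc n} (hH : ContDiff ℝ (⊤ : ℕ∞) H) {x : Euc n}
    (hx : (jac H x).det ≠ 0) :
    ∃ U : Set (Euc n), IsOpen U ∧ x ∈ U ∧ InjOn H U ∧
      (∀ z ∈ U, 0 < (jac H x).det * (jac H z).det) ∧
      ∀ V ∈ 𝓝 x, H '' V ∈ 𝓝 (H x) := by
  have hd : (fderiv ℝ H x).det ≠ 0 := by rw [det_fderiv_eq]; exact hx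
  set e := (fderiv ℝ H x).toContinuousLinearEquivOfDetNeZero hd with he
  have hs : HasStrictFDerivAt H (e : Euc n →L[ℝ] Euc n) x := by
    have := hH.contDiffAt.hasStrictFDerivAt (x := x) (by simp)
    simpa [he] using this
  have ho : IsOpen {z | 0 < (jac H x).det * (jac H z).det} :=
    isOpen_lt continuous_const (continuous_const.mul (jac_det_continuous hH))
  refine ⟨(hs.toOpenPartialHomeomorph H).source ∩ {z | 0 < (jac H x).det * (jac H z).det},
    (hs.toOpenPartialHomeomorph H).open_source.inter ho, ⟨hs.mem_toOpenPartialHomeomorph_source, ?_⟩,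
    ?_, fun z hz => hz.2, ?_⟩
  · exact mul_self_pos.2 hx
  · exact (hs.toOpenPartialHomeomorph H).injOn.mono inter_subset_left
  · intro V hV
    rw [← hs.map_nhds_eq_of_equiv]
    exact image_mem_map hV

theorem degL_piece {H : Euc n → Euc n} (hH : ContDiff ℝ (⊤ : ℕ∞) H) {x : Euc n}
    {V : Set (Euc n)} (hV : IsOpen V) (hinj : InjOn H V)
    (hpos : ∀ z ∈ V, 0 < (jac H x).det * (jac H z).det)
    {g : Euc n → ℝ} (hg : tsupport g ⊆ H '' V) (hg1 : ∫ y, g y = 1) :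
    ∃ m : ℤ, degL H V g = m := by
  have key := integral_image_eq_integral_abs_det_fderiv_smul volume hV.measurableSet
    (fun z _ => (hH.differentiable (by simp) z).hasFDerivAt.hasFDerivWithinAt) hinj g
  rw [setIntegral_eq_integral_of_forall_compl_eq_zero
    (fun y hy => image_eq_zero_of_notMem_tsupport fun h => hy (hg h)), hg1] at key
  simp only [det_fderiv_eq] at key
  rcases lt_or_ge 0 (jac H x).det with h0 | h0
  · refine ⟨1, ?_⟩
    rw [degL, Int.cast_one, key]
    refine setIntegral_congr_fun hV.measurableSet fun z hz => ?_
    have : 0 < (jac H z).det := pos_of_mul_pos_right (hpos z hz) h0.le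
    simp only [abs_of_pos this, smul_eq_mul]; ring
  · refine ⟨-1, ?_⟩
    rw [degL, Int.cast_neg, Int.cast_one, key, ← integral_neg]
    refine setIntegral_congr_fun hV.measurableSet fun z hz => ?_
    have : (jac H z).det < 0 := by
      by_contra hc
      have := mul_nonpos_of_nonpos_of_nonneg h0 (not_lt.1 hc)
      linarith [hpos z hz]
    simp only [abs_of_neg this, smul_eq_mul]; ring

theorem degL_int {H : Euc n → Euc n} (hH : ContDiff ℝ (⊤ : ℕ∞) H) {O : Set (Euc n)}
    (hO : IsOpen O) (hOb : Bornology.IsBounded O) {p : Euc n} {ρ : ℝ} (hρ : 0 < ρ)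
    (hfr : ∀ x ∈ frontier O, H x ∉ ball p ρ) :
    ∃ c : ℤ, ∀ g : Euc n → ℝ, ContDiff ℝ (⊤ : ℕ∞) g → tsupport g ⊆ ball p (ρ / 2) →
      degL H O g = c * ∫ y, g y := by
  obtain ⟨c, hc⟩ := degL_const hH hO hOb hρ hfr
  suffices ∃ g : Euc n → ℝ, ContDiff ℝ (⊤ : ℕ∞) g ∧ tsupport g ⊆ ball p (ρ / 2) ∧
      ∫ y, g y = 1 ∧ ∃ m : ℤ, degL H O g = m by
    obtain ⟨g, h1, h2, h3, m, h4⟩ := this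
    have := hc g h1 h2
    rw [h4, h3, mul_one] at this
    exact ⟨m, fun g hg hgs => by rw [hc g hg hgs, this]⟩
  -- regular value
  obtain ⟨y, hyb, hyreg⟩ : ∃ y ∈ ball p (ρ / 2), ∀ x, H x = y → (jac H x).det ≠ 0 := by
    by_contra! hcon
    have h0 : volume (H '' {x | (jac H x).det = 0}) = 0 := by
      refine addHaar_image_eq_zero_of_det_fderivWithin_eq_zero volume
        (f' := fderiv ℝ H)
        (fun x _ => (hH.differentiable (by simp) x).hasFDerivAt.hasFDerivWithinAt)
        (fun x hx => by rw [det_fderiv_eq]; exact hx)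
    have h1 : ball p (ρ / 2) ⊆ H '' {x | (jac H x).det = 0} := fun y hy => by
      obtain ⟨x, hx1, hx2⟩ := hcon y hy
      exact ⟨x, hx2, hx1⟩
    have := (measure_ball_pos volume p (half_pos hρ)).trans_le (measure_mono h1)
    simp [h0] at this
  set S := closure O ∩ H ⁻¹' {y} with hS
  have hSc : IsCompact S := hOb.isCompact_closure.inter_right
    (isClosed_singleton.preimage hH.continuous)
  have hSO : S ⊆ O := by
    intro x hx
    by_contra hxO
    have : x ∈ frontier O := by rw [frontier, hO.interior_eq]; exact ⟨hx.1, hxO⟩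
    refine hfr x this ?_
    have hh : H x = y := hx.2
    rw [hh]
    exact ball_subset_ball (by linarith) hyb
  have hloc : ∀ x ∈ S, _ := fun x hx => local_inj hH (hyreg x hx.2)
  choose! U hUo hxU hUinj hUpos hUnhds using hloc
  have hSf : S.Finite := by
    obtain ⟨t, ht, hcov⟩ := hSc.elim_nhds_subcover U fun x hx => (hUo x hx).mem_nhds (hxU x hx)
    refine t.finite_toSet.subset fun x hx => ?_
    obtain ⟨z, hz, hxz⟩ := mem_iUnion₂.1 (hcov hx)
    have : x = z := hUinj z (ht z hz) hxz (hxU z (ht z hz)) (by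
      have h1 : H x = y := hx.2
      have h2 : H z = y := (ht z hz).2
      rw [h1, h2])
    rw [this]; exact hz
  obtain ⟨U', hU', hdisj⟩ := hSf.t2_separation
  set V : Euc n → Set (Euc n) := fun x => U x ∩ U' x ∩ O with hV
  have hVo : ∀ x ∈ S, IsOpen (V x) := fun x hx => ((hUo x hx).inter (hU' x).2).inter hO
  have hxV : ∀ x ∈ S, x ∈ V x := fun x hx => ⟨⟨hxU x hx, (hU' x).1⟩, hSO hx⟩
  set K := H '' (closure O \ ⋃ x ∈ S, V x) with hK
  have hKc : IsCompact K := by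
    refine IsCompact.image ?_ hH.continuous
    exact hOb.isCompact_closure.diff (isOpen_biUnion hVo)
  have hyK : y ∉ K := by
    rintro ⟨x, ⟨hx1, hx2⟩, hx3⟩
    exact hx2 (mem_biUnion (x := x) ⟨hx1, hx3⟩ (hxV x ⟨hx1, hx3⟩))
  have hW : ball p (ρ / 2) ∩ (⋂ x ∈ S, H '' V x) ∩ Kᶜ ∈ 𝓝 y := by
    refine inter_mem (inter_mem (isOpen_ball.mem_nhds hyb) ?_) (hKc.isClosed.isOpen_compl.mem_nhds hyK)
    refine (biInter_mem hSf).2 fun x hx => ?_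
    have := hUnhds x hx (V x) ((hVo x hx).mem_nhds (hxV x hx))
    have hh : H x = y := hx.2
    rwa [hh] at this
  obtain ⟨ε, hε, hεW⟩ := Metric.nhds_basis_closedBall.mem_iff.1 hW
  let b : ContDiffBump y := ⟨ε / 2, ε, by positivity, by linarith⟩
  have hgt : tsupport (b.normed volume) = closedBall y ε := b.tsupport_normed_eq
  have hg1 : ∫ z, b.normed volume z = 1 := b.integral_normed
  have hgs : ContDiff ℝ (⊤ : ℕ∞) (b.normed volume) := b.contDiff_normed
  set g := b.normed volume
  refine ⟨g, hgs, ?_, hg1, ?_⟩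
  · rw [hgt]; exact fun z hz => (hεW hz).1.1
  have hpiece : ∀ x ∈ S, ∃ m : ℤ, degL H (V x) g = m := fun x hx => by
    refine degL_piece hH (x := x) (hVo x hx) ((hUinj x hx).mono fun z hz => hz.1.1)
      (fun z hz => hUpos x hx z hz.1.1) ?_ hg1
    rw [hgt]
    exact fun z hz => mem_iInter₂.1 (hεW hz).1.2 x hx
  choose! m hm using hpiece
  refine ⟨∑ x ∈ hSf.toFinset, m x, ?_⟩
  have hVO : (⋃ x ∈ hSf.toFinset, V x) ⊆ O := iUnion₂_subset fun x _ z hz => hz.2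
  have hcont : Continuous fun x => g (H x) * (jac H x).det :=
    (hgs.continuous.comp hH.continuous).mul (jac_det_continuous hH)
  have e1 : degL H O g = ∫ x in ⋃ x ∈ hSf.toFinset, V x, g (H x) * (jac H x).det := by
    rw [degL]
    refine setIntegral_eq_of_subset_of_forall_sdiff_eq_zero hO.measurableSet hVO fun x hx => ?_
    have : H x ∉ tsupport g := by
      rw [hgt]
      intro hmem
      refine (hεW hmem).2 ⟨x, ⟨subset_closure hx.1, ?_⟩, rfl⟩
      simpa using hx.2
    rw [image_eq_zero_of_notMem_tsupport this, zero_mul]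
  rw [e1, integral_biUnion_finset]
  · push_cast
    refine Finset.sum_congr rfl fun x hx => ?_
    exact hm x (by simpa using hx)
  · exact fun x hx => (hVo x (by simpa using hx)).measurableSet
  · intro x hx z hz hxz
    exact (hdisj (by simpa using hx) (by simpa using hz) hxz).mono
      (fun w hw => hw.1.2) (fun w hw => hw.1.2)
  · intro x hx
    refine IntegrableOn.mono_set (t := closure O) ?_
      (fun w hw => subset_closure hw.2)
    exact hcont.continuousOn.integrableOn_compact hOb.isCompact_closure

end

section
open Filter Topology

variable {n : ℕ}

theorem int_const {φ : ℝ → ℝ} (hφ : ContinuousOn φ (Icc 0 1))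
    (hintg : ∀ t ∈ Icc (0:ℝ) 1, ∃ m : ℤ, φ t = m) : φ 0 = φ 1 := by
  obtain ⟨a, ha⟩ := hintg 0 (by simp)
  obtain ⟨b, hb⟩ := hintg 1 (by simp)
  have key : ∀ v ∈ uIcc (φ 0) (φ 1), ∃ m : ℤ, v = m := by
    intro v hv
    have := intermediate_value_uIcc (a := (0:ℝ)) (b := 1) (f := φ)
      (by rwa [uIcc_of_le zero_le_one]) hv
    obtain ⟨t, ht, rfl⟩ := this
    rw [uIcc_of_le zero_le_one] at ht
    exact hintg t ht
  by_contra hne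
  rw [ha, hb] at hne
  have hab : a ≠ b := fun h => hne (by rw [h])
  rcases lt_or_gt_of_ne hab with h | h
  · have h' : (a:ℝ) + 1 ≤ b := by exact_mod_cast h
    obtain ⟨m, hm⟩ := key (a + 1/2) (by rw [ha, hb, mem_uIcc]; left; constructor <;> linarith)
    have h1 : (2 * a + 1 : ℤ) = 2 * m := by
      have : (2 * a + 1 : ℝ) = 2 * m := by linarith
      exact_mod_cast this
    omega
  · have h' : (b:ℝ) + 1 ≤ a := by exact_mod_cast h
    obtain ⟨m, hm⟩ := key (b + 1/2) (by rw [ha, hb, mem_uIcc]; right; constructor <;> linarith)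
    have h1 : (2 * b + 1 : ℤ) = 2 * m := by
      have : (2 * b + 1 : ℝ) = 2 * m := by linarith
      exact_mod_cast this
    omega

theorem jac_homotopy {G : Euc n → Euc n} (hG : ContDiff ℝ (⊤ : ℕ∞) G) (t : ℝ) (x : Euc n) :
    jac (fun z => z + t • (G z - z)) x = 1 + t • (jac G x - 1) := by
  have h1 : HasFDerivAt (fun z => z + t • (G z - z))
      (ContinuousLinearMap.id ℝ (Euc n) + t • (fderiv ℝ G x - ContinuousLinearMap.id ℝ (Euc n))) x :=
    (hasFDerivAt_id x).add
      ((((hG.differentiable (by simp) x).hasFDerivAt).sub (hasFDerivAt_id x)).const_smul t)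
  ext i j
  rw [jac_apply, h1.fderiv]
  simp [jac_apply, Matrix.one_apply]

/-- homotopy to the identity -/
theorem degL_homotopy {G : Euc n → Euc n} (hG : ContDiff ℝ (⊤ : ℕ∞) G) {O : Set (Euc n)}
    (hO : IsOpen O) (hOb : Bornology.IsBounded O) {p : Euc n} {ρ : ℝ} (hρ : 0 < ρ)
    (hfr : ∀ x ∈ frontier O, ∀ t ∈ Icc (0:ℝ) 1, x + t • (G x - x) ∉ ball p ρ)
    {g : Euc n → ℝ} (hg : ContDiff ℝ (⊤ : ℕ∞) g) (hgs : tsupport g ⊆ ball p (ρ / 2))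
    (hgO : tsupport g ⊆ O) (hg1 : ∫ y, g y = 1) : degL G O g = 1 := by
  set Ht : ℝ → Euc n → Euc n := fun t x => x + t • (G x - x) with hHt
  have hHs : ∀ t, ContDiff ℝ (⊤ : ℕ∞) (Ht t) := fun t =>
    contDiff_id.add ((hG.sub contDiff_id).const_smul t)
  set φ : ℝ → ℝ := fun t => ∫ x in closure O, g (Ht t x) * (jac (Ht t) x).det with hφ
  have hφd : ∀ t ∈ Icc (0:ℝ) 1, φ t = degL (Ht t) O g := by
    intro t ht
    refine setIntegral_eq_of_subset_of_forall_sdiff_eq_zero isClosed_closure.measurableSet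
      subset_closure fun x hx => ?_
    have hxf : x ∈ frontier O := by rw [frontier, hO.interior_eq]; exact hx
    have := hfr x hxf t ht
    have h2 : Ht t x ∉ tsupport g := fun h => this (ball_subset_ball (by linarith) (hgs h))
    rw [image_eq_zero_of_notMem_tsupport h2, zero_mul]
  have hφc : Continuous φ := by
    refine continuous_parametric_integral_of_continuous ?_ hOb.isCompact_closure
    have hGc := hG.continuous
    have hgc := hg.continuous
    have hj : Continuous fun x => jac G x :=
      continuous_matrix fun i j => (jac_entry_contDiff hG i j).continuous
    have e : ∀ t x, (jac (Ht t) x) = 1 + t • (jac G x - 1) := fun t x => jac_homotopy hG t x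
    simp only [Function.uncurry_def, e]
    refine Continuous.mul (by fun_prop) (Continuous.matrix_det ?_)
    exact continuous_const.add (continuous_fst.smul ((hj.comp continuous_snd).sub continuous_const))
  have hI := int_const hφc.continuousOn fun t ht => by
    obtain ⟨c, hc⟩ := degL_int (hHs t) hO hOb hρ (p := p) fun x hx => hfr x hx t ht
    refine ⟨c, ?_⟩
    rw [hφd t ht, hc g hg hgs, hg1, mul_one]
  have h1 : Ht 1 = G := by ext1 x; simp [hHt]
  have h0 : Ht 0 = fun x => x := by ext1 x; simp [hHt]
  rw [hφd 0 (by simp), hφd 1 (by simp), h1] at hI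
  rw [← hI, degL]
  have : ∀ x, (jac (Ht 0) x).det = 1 := fun x => by
    rw [hHt, jac_homotopy hG]; simp
  simp only [this, mul_one]
  simp only [h0]
  rw [setIntegral_eq_integral_of_forall_compl_eq_zero, hg1]
  exact fun x hx => image_eq_zero_of_notMem_tsupport fun h => hx (hgO h)

set_option maxHeartbeats 400000 in
theorem top_deg {X Y : Set (Euc n)} (hX : IsOpen X) (hY : IsOpen Y) {h f : Euc n → Euc n}
    (hhf : IsHomeoOn h f X Y) {x0 : Euc n} (hx0 : x0 ∈ X) :
    ∃ r > 0, closedBall x0 r ⊆ X ∧ ∃ ρ > 0, closedBall (h x0) ρ ⊆ Y ∧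
      (∀ y ∈ closedBall (h x0) ρ, f y ∈ ball x0 r) ∧
      ∃ δ > 0, ∀ H : Euc n → Euc n, ContDiff ℝ (⊤ : ℕ∞) H →
        (∀ x ∈ closedBall x0 r, dist (H x) (h x) < δ) →
        ∃ c : ℤ, (c = 1 ∨ c = -1) ∧ ∀ g : Euc n → ℝ, ContDiff ℝ (⊤ : ℕ∞) g →
          tsupport g ⊆ ball (h x0) ρ → degL H (ball x0 r) g = c * ∫ y, g y := by
  set y0 := h x0 with hy0
  have hy0Y : y0 ∈ Y := hhf.mapsTo hx0
  have hfy0 : f y0 = x0 := hhf.left_inv x0 hx0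
  have hinj : InjOn h X := fun a ha b hb hab => by
    rw [← hhf.left_inv a ha, ← hhf.left_inv b hb, hab]
  have hfinj : InjOn f Y := fun a ha b hb hab => by
    rw [← hhf.right_inv a ha, ← hhf.right_inv b hb, hab]
  obtain ⟨r, hr, hrX⟩ := Metric.nhds_basis_closedBall.mem_iff.1 (hX.mem_nhds hx0)
  -- d
  have hd : (h '' sphere x0 r)ᶜ ∈ 𝓝 y0 := by
    refine IsClosed.compl_mem_nhds ?_ ?_
    · exact ((isCompact_sphere x0 r).image_of_continuousOn
        (hhf.continuousOn.mono (sphere_subset_closedBall.trans hrX))).isClosed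
    · rintro ⟨x, hx, hxy⟩
      have := hinj (hrX (sphere_subset_closedBall hx)) hx0 hxy
      rw [this, mem_sphere, dist_self] at hx
      exact hr.ne hx
  obtain ⟨d2, hd2, hdball⟩ := Metric.nhds_basis_ball.mem_iff.1 hd
  obtain ⟨d, hd0, rfl⟩ : ∃ d > 0, d2 = 2 * d := ⟨d2 / 2, by positivity, by ring⟩
  have hds : ∀ x ∈ sphere x0 r, 2 * d ≤ dist (h x) y0 := fun x hx => by
    by_contra hc
    exact hdball (not_le.1 hc) ⟨x, hx, rfl⟩
  -- s
  have hs : Y ∩ f ⁻¹' ball x0 r ∈ 𝓝 y0 := by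
    refine inter_mem (hY.mem_nhds hy0Y) ?_
    have := hhf.continuousOn_inv.continuousAt (hY.mem_nhds hy0Y)
    refine this.preimage_mem_nhds ?_
    rw [hfy0]; exact ball_mem_nhds _ hr
  obtain ⟨s1, hs1, hs1ball⟩ := Metric.nhds_basis_closedBall.mem_iff.1 hs
  obtain ⟨s, hs0, hsd, hss⟩ : ∃ s > 0, s < d / 2 ∧ 2 * s ≤ s1 :=
    ⟨min (d / 4) (s1 / 2), by positivity, by linarith [min_le_left (d/4) (s1/2)],
      by linarith [min_le_right (d/4) (s1/2)]⟩
  have hs2Y : closedBall y0 (2 * s) ⊆ Y := fun y hy => (hs1ball (closedBall_subset_closedBall hss hy)).1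
  have hsY : closedBall y0 s ⊆ Y := (closedBall_subset_closedBall (by linarith)).trans hs2Y
  have hsf : ∀ y ∈ closedBall y0 s, f y ∈ ball x0 r := fun y hy =>
    (hs1ball (closedBall_subset_closedBall (by linarith) hy)).2
  -- e
  have he : (f '' sphere y0 s)ᶜ ∈ 𝓝 x0 := by
    refine IsClosed.compl_mem_nhds ?_ ?_
    · exact ((isCompact_sphere y0 s).image_of_continuousOn
        (hhf.continuousOn_inv.mono (sphere_subset_closedBall.trans hsY))).isClosed
    · rintro ⟨y, hy, hxy⟩
      have := hfinj (hsY (sphere_subset_closedBall hy)) hy0Y (hxy.trans hfy0.symm)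
      rw [this, mem_sphere, dist_self] at hy
      exact hs0.ne hy
  obtain ⟨e2, he2, heball⟩ := Metric.nhds_basis_ball.mem_iff.1 he
  obtain ⟨e, he0, rfl⟩ : ∃ e > 0, e2 = 2 * e := ⟨e2 / 2, by positivity, by ring⟩
  have hes : ∀ y ∈ sphere y0 s, 2 * e ≤ dist (f y) x0 := fun y hy => by
    by_contra hc
    exact heball (not_le.1 hc) ⟨y, hy, rfl⟩
  -- F
  obtain ⟨F, hF, hFf⟩ : ∃ F : Euc n → Euc n, ContDiff ℝ (⊤ : ℕ∞) F ∧
      ∀ y ∈ closedBall y0 s, dist (F y) (f y) < e := by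
    obtain ⟨f1, hf1⟩ := ContinuousMap.exists_restrict_eq (isClosed_closedBall (x := y0) (ε := s))
      ⟨_, (hhf.continuousOn_inv.mono hsY).domRestrict⟩
    obtain ⟨F, hF, hF2, -⟩ := f1.continuous.exists_contDiff_approx ⊤ (ε := fun _ => e)
      continuous_const (fun _ => he0)
    refine ⟨F, hF, fun y hy => ?_⟩
    have := congrArg (fun k => k ⟨y, hy⟩) hf1
    simp at this
    rw [← this]; exact hF2 y
  have hFfr : ∀ y ∈ frontier (ball y0 s), F y ∉ ball x0 e := by
    intro y hy hmem
    have hys := frontier_ball_subset_sphere hy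
    have h1 := hFf y (sphere_subset_closedBall hys)
    have h2 := hes y hys
    have h3 := dist_triangle_left (f y) x0 (F y)
    rw [mem_ball] at hmem
    linarith
  obtain ⟨cF, hcF⟩ := degL_int hF isOpen_ball isBounded_ball he0 hFfr
  -- delta
  have huc : UniformContinuousOn f (closedBall y0 (2 * s)) :=
    (isCompact_closedBall _ _).uniformContinuousOn_of_continuous (hhf.continuousOn_inv.mono hs2Y)
  obtain ⟨δ1, hδ1, hδuc⟩ := Metric.uniformContinuousOn_iff.1 huc e he0
  refine ⟨r, hr, hrX, s, hs0, hsY, hsf, min δ1 (min d s), by positivity, fun H hH hHh => ?_⟩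
  have hHd : ∀ x ∈ closedBall x0 r, dist (H x) (h x) < d := fun x hx =>
    (hHh x hx).trans_le ((min_le_right _ _).trans (min_le_left _ _))
  have hHs : ∀ x ∈ closedBall x0 r, dist (H x) (h x) < s := fun x hx =>
    (hHh x hx).trans_le ((min_le_right _ _).trans (min_le_right _ _))
  have hHe : ∀ x ∈ closedBall x0 r, H x ∈ closedBall y0 s → dist x (f (H x)) < e := by
    intro x hx hxs
    have h1 : dist (h x) (H x) < δ1 := by
      rw [dist_comm]; exact (hHh x hx).trans_le (min_le_left _ _)
    have h2 := hδuc (h x) ?_ (H x) (closedBall_subset_closedBall (by linarith) hxs) h1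
    · rwa [hhf.left_inv x (hrX hx)] at h2
    · rw [mem_closedBall] at hxs ⊢
      have := dist_triangle_left (h x) y0 (H x)
      linarith [hHs x hx]
  have hHfr : ∀ x ∈ frontier (ball x0 r), H x ∉ ball y0 d := by
    intro x hx hmem
    have hxs := frontier_ball_subset_sphere hx
    have h1 := hHd x (sphere_subset_closedBall hxs)
    have h2 := hds x hxs
    have h3 := dist_triangle_left (h x) y0 (H x)
    rw [mem_ball] at hmem
    linarith
  obtain ⟨cH, hcH⟩ := degL_int hH isOpen_ball isBounded_ball hd0 hHfr
  refine ⟨cH, ?_, fun g hg hgs => hcH g hg (hgs.trans (ball_subset_ball hsd.le))⟩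
  -- the set O
  set O' := ball x0 r ∩ H ⁻¹' ball y0 s with hO'
  have hO'o : IsOpen O' := isOpen_ball.inter (isOpen_ball.preimage hH.continuous)
  have hO'b : Bornology.IsBounded O' := isBounded_ball.subset inter_subset_left
  have hx0O' : x0 ∈ O' := ⟨mem_ball_self hr, hHs x0 (mem_closedBall_self hr.le)⟩
  obtain ⟨ε1, hε1, hε1O⟩ := Metric.nhds_basis_closedBall.mem_iff.1 (hO'o.mem_nhds hx0O')
  obtain ⟨ε, hε0, hεe, hεε⟩ : ∃ ε > 0, ε < e / 2 ∧ ε ≤ ε1 :=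
    ⟨min (e / 4) ε1, by positivity, by linarith [min_le_left (e/4) ε1], min_le_right _ _⟩
  let b : ContDiffBump x0 := ⟨ε / 2, ε, by positivity, by linarith⟩
  have hgt : tsupport (b.normed volume) = closedBall x0 ε := b.tsupport_normed_eq
  have hg1 : ∫ z, b.normed volume z = 1 := b.integral_normed
  have hgs : ContDiff ℝ (⊤ : ℕ∞) (b.normed volume) := b.contDiff_normed
  set g := b.normed volume
  have hge : tsupport g ⊆ ball x0 (e / 2) := by rw [hgt]; exact closedBall_subset_ball hεe
  have hgO : tsupport g ⊆ O' := by
    rw [hgt]; exact (closedBall_subset_closedBall hεε).trans hε1O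
  set Φ : Euc n → ℝ := fun y => g (F y) * (jac F y).det with hΦ
  have hΦs : ContDiff ℝ (⊤ : ℕ∞) Φ :=
    (hgs.comp hF).mul (contDiff_det (jac_entry_contDiff hF))
  have hΦfr : ∀ y ∈ frontier (ball y0 s), Φ =ᶠ[𝓝 y] 0 := fun y hy => by
    have : F y ∉ tsupport g := fun hc => hFfr y hy (ball_subset_ball (by linarith) (hge hc))
    filter_upwards [comp_eventually_zero hF.continuous this] with z hz
    simp only [hΦ]; rw [hz]; simp
  obtain ⟨hGs, -⟩ := contDiff_indicator isOpen_ball hΦs hΦfr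
  have hGt : tsupport ((ball y0 s).indicator Φ) ⊆ ball y0 (d / 2) :=
    (closure_minimal (support_indicator_subset.trans ball_subset_closedBall)
      isClosed_closedBall).trans (closedBall_subset_ball hsd)
  have e1 := hcH _ hGs hGt
  have e2 : ∫ y, (ball y0 s).indicator Φ y = cF := by
    rw [integral_indicator measurableSet_ball]
    have := hcF g hgs hge
    rw [hg1, mul_one] at this
    exact this
  have e3 : degL H (ball x0 r) ((ball y0 s).indicator Φ) = degL (F ∘ H) O' g := by
    rw [degL, degL, ← integral_indicator measurableSet_ball, ← integral_indicator hO'o.measurableSet]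
    congr 1
    ext x
    by_cases h1 : x ∈ ball x0 r
    · by_cases h2 : H x ∈ ball y0 s
      · have h3 : x ∈ O' := ⟨h1, h2⟩
        rw [indicator_of_mem h1, indicator_of_mem h2, indicator_of_mem h3,
          jac_comp (hF.differentiable (by simp) _) (hH.differentiable (by simp) _), Matrix.det_mul]
        simp only [hΦ, Function.comp]; ring
      · have h3 : x ∉ O' := fun h => h2 h.2
        rw [indicator_of_mem h1, indicator_of_notMem h2, indicator_of_notMem h3, zero_mul]
    · have h3 : x ∉ O' := fun h => h1 h.1
      rw [indicator_of_notMem h1, indicator_of_notMem h3]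
  have e4 : degL (F ∘ H) O' g = 1 := by
    refine degL_homotopy (hF.comp hH) hO'o hO'b he0 (p := x0) ?_ hgs hge hgO hg1
    intro x hx t ht hmem
    rw [frontier, hO'o.interior_eq] at hx
    have hx1 : x ∈ closedBall x0 r :=
      closure_minimal (inter_subset_left.trans ball_subset_closedBall) isClosed_closedBall hx.1
    have hsub : closure O' ⊆ H ⁻¹' closedBall y0 s :=
      closure_minimal (fun z hz => mem_preimage.2 (ball_subset_closedBall (mem_preimage.1 hz.2)))
        (isClosed_closedBall.preimage hH.continuous)
    have hx2 : H x ∈ closedBall y0 s := hsub hx.1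
    have hx3 : x ∈ ball x0 r := by
      by_contra hc
      have h5 : x ∈ frontier (ball x0 r) := by
        rw [frontier, isOpen_ball.interior_eq]
        exact ⟨closure_mono inter_subset_left hx.1, hc⟩
      exact hHfr x h5 (closedBall_subset_ball (by linarith) hx2)
    have hx4 : H x ∈ sphere y0 s := by
      rw [mem_sphere]
      refine le_antisymm hx2 (not_lt.1 fun hc => hx.2 ⟨hx3, hc⟩)
    have h6 := hHe x hx1 hx2
    have h7 := hFf (H x) hx2
    have h8 := hes (H x) hx4
    have h9 : x + t • (F (H x) - x) ∈ ball (f (H x)) e := by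
      have h6' : x ∈ ball (f (H x)) e := h6
      have h7' : F (H x) ∈ ball (f (H x)) e := h7
      exact (convex_ball (f (H x)) e).add_smul_sub_mem h6' h7' ht
    have h10 := dist_triangle_left (f (H x)) x0 (x + t • (F (H x) - x))
    rw [mem_ball] at h9
    have h11 : dist (x + t • (F (H x) - x)) x0 < e := hmem
    linarith
  rw [e3, e4, e2] at e1
  have e5 : cH * cF = 1 := by
    have : (cH : ℝ) * cF = 1 := e1.symm
    exact_mod_cast this
  exact Int.eq_one_or_neg_one_of_mul_eq_one e5

end

section
open Filter Topology

variable {n : ℕ}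

theorem eLpNorm_natPow {α : Type*} [MeasurableSpace α] {μ : Measure α} {u : α → ℝ} {m : ℕ}
    (hm : m ≠ 0) : eLpNorm u m μ ^ m = ∫⁻ x, ‖u x‖ₑ ^ m ∂μ := by
  have h0 : (m : ℝ≥0∞) ≠ 0 := by exact_mod_cast hm
  rw [eLpNorm_eq_lintegral_rpow_enorm_toReal h0 (by simp)]
  simp only [ENNReal.toReal_natCast, ENNReal.rpow_natCast]
  rw [← ENNReal.rpow_natCast, ← ENNReal.rpow_mul]
  have : (1 / (m : ℝ)) * m = 1 := by field_simp
  rw [this, ENNReal.rpow_one]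

theorem translation_Lp {u : Euc n → ℝ} {m : ℕ} (hm : m ≠ 0)
    (hu : MemLp u m volume) :
    Tendsto (fun y : Euc n => ∫⁻ x, ‖u (x - y) - u x‖ₑ ^ m) (𝓝 0) (𝓝 0) := by
  have : Fact ((1 : ℝ≥0∞) ≤ (m : ℝ≥0∞)) := ⟨by exact_mod_cast Nat.one_le_iff_ne_zero.2 hm⟩
  have : Fact ((m : ℝ≥0∞) ≠ ∞) := ⟨by simp⟩
  set U := hu.toLp u with hU
  have hc : Continuous fun y : Euc n => (DomAddAct.mk (-y) +ᵥ U : Lp ℝ (m : ℝ≥0∞) volume) := by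
    have h1 : Continuous fun y : Euc n => (DomAddAct.mk (-y) : (Euc n)ᵈᵃᵃ) :=
      DomAddAct.continuous_mk.comp continuous_neg
    exact h1.vadd continuous_const
  have h2 : Tendsto (fun y : Euc n => edist (DomAddAct.mk (-y) +ᵥ U) U) (𝓝 0) (𝓝 0) := by
    have := (hc.edist continuous_const (g := fun _ => U)).tendsto 0
    simpa using this
  have h3 : ∀ y : Euc n, edist (DomAddAct.mk (-y) +ᵥ U) U ^ m = ∫⁻ x, ‖u (x - y) - u x‖ₑ ^ m := by
    intro y
    rw [hU, DomAddAct.mk_vadd_toLp, Lp.edist_toLp_toLp, eLpNorm_natPow hm]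
    congr 1
    ext x
    simp [sub_eq_neg_add]
  have h4 := ENNReal.Tendsto.pow (n := m) h2
  simp only [h3] at h4
  simpa [hm] using h4

theorem jensen_pow {α : Type*} [MeasurableSpace α] {ν : Measure α} [IsProbabilityMeasure ν]
    {F : α → ℝ} (hF : AEStronglyMeasurable F ν) {m : ℕ} (hm : m ≠ 0) :
    (∫⁻ y, ‖F y‖ₑ ∂ν) ^ m ≤ ∫⁻ y, ‖F y‖ₑ ^ m ∂ν := by
  rw [← eLpNorm_natPow hm, ← eLpNorm_one_eq_lintegral_enorm]
  gcongr
  exact eLpNorm_le_eLpNorm_of_exponent_le (by exact_mod_cast Nat.one_le_iff_ne_zero.2 hm) hF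

/-- mollification converges in `L^m`. -/
theorem mollify_Lp {u : Euc n → ℝ} {m : ℕ} (hm : m ≠ 0) (hum : Measurable u)
    (hu : MemLp u m volume) (φ : ℕ → ContDiffBump (0 : Euc n))
    (hφ : Tendsto (fun k => (φ k).rOut) atTop (𝓝 0)) :
    Tendsto (fun k => ∫⁻ x, ‖(∫ t, (φ k).normed volume t * u (x - t)) - u x‖ₑ ^ m)
      atTop (𝓝 0) := by
  have hloc : LocallyIntegrable u volume :=
    hu.locallyIntegrable (by exact_mod_cast Nat.one_le_iff_ne_zero.2 hm)
  rw [ENNReal.tendsto_nhds_zero]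
  intro ε hε
  have ht := ENNReal.tendsto_nhds_zero.1 (translation_Lp hm hu) ε hε
  obtain ⟨δ, hδ, hball⟩ := Metric.eventually_nhds_iff_ball.1 ht
  filter_upwards [hφ.eventually (gt_mem_nhds hδ)] with k hk
  set ρ := (φ k).normed volume with hρ
  have hρ0 : ∀ t, 0 ≤ ρ t := (φ k).nonneg_normed
  have hρ1 : ∫ t, ρ t = 1 := (φ k).integral_normed
  have hρc : Continuous ρ := ((φ k).contDiff_normed (n := 0)).continuous
  have hρs : HasCompactSupport ρ := (φ k).hasCompactSupport_normed
  have hρi : Integrable ρ := hρc.integrable_of_hasCompactSupport hρs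
  set ν : Measure (Euc n) := volume.withDensity (fun t => ENNReal.ofReal (ρ t)) with hν
  have hρm : Measurable fun t => ENNReal.ofReal (ρ t) := hρc.measurable.ennreal_ofReal
  have : IsProbabilityMeasure ν := ⟨by
    rw [hν, withDensity_apply _ MeasurableSet.univ, Measure.restrict_univ,
      ← ofReal_integral_eq_lintegral_ofReal hρi (Eventually.of_forall hρ0), hρ1]
    simp⟩
  have h1 : ∀ x, ‖(∫ t, ρ t * u (x - t)) - u x‖ₑ ≤ ∫⁻ t, ‖u (x - t) - u x‖ₑ ∂ν := by
    intro x
    have hi : Integrable fun t => ρ t * u (x - t) := by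
      have hl : LocallyIntegrable (fun t => u (x - t)) volume := by
        have hp : MemLp (fun t => u (x - t)) m volume :=
          hu.comp_measurePreserving (Measure.measurePreserving_sub_left volume x)
        exact hp.locallyIntegrable (by exact_mod_cast Nat.one_le_iff_ne_zero.2 hm)
      exact hl.integrable_smul_left_of_hasCompactSupport hρc hρs
    have e : (∫ t, ρ t * u (x - t)) - u x = ∫ t, ρ t * (u (x - t) - u x) := by
      simp_rw [mul_sub]
      rw [integral_sub hi (hρi.mul_const _), integral_mul_const, hρ1, one_mul]
    rw [e]
    refine (enorm_integral_le_lintegral_enorm _).trans_eq ?_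
    rw [hν, lintegral_withDensity_eq_lintegral_mul _ hρm]
    · congr 1
      ext t
      simp only [Pi.mul_apply, enorm_mul]
      rw [Real.enorm_of_nonneg (hρ0 t)]
    · exact ((hum.comp (measurable_const.sub measurable_id)).sub measurable_const).enorm
  calc ∫⁻ x, ‖(∫ t, ρ t * u (x - t)) - u x‖ₑ ^ m
      ≤ ∫⁻ x, ∫⁻ t, ‖u (x - t) - u x‖ₑ ^ m ∂ν := by
        refine lintegral_mono fun x => ?_
        refine (pow_le_pow_left' (h1 x) m).trans (jensen_pow ?_ hm)
        exact ((hum.comp (measurable_const.sub measurable_id)).sub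
          measurable_const).aestronglyMeasurable
    _ = ∫⁻ t, (∫⁻ x, ‖u (x - t) - u x‖ₑ ^ m) ∂ν := by
        refine lintegral_lintegral_swap ?_
        refine Measurable.aemeasurable ?_
        simp only [Function.uncurry_def]
        exact ((((hum.comp (measurable_fst.sub measurable_snd)).sub
          (hum.comp measurable_fst)).enorm).pow_const m)
    _ ≤ ∫⁻ t, ε ∂ν := by
        refine lintegral_mono_ae ?_
        have : ∀ᵐ t ∂ν, t ∈ ball (0 : Euc n) δ := by
          rw [hν, ae_withDensity_iff hρm]
          refine Eventually.of_forall fun t ht => ?_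
          have : t ∈ Function.support ρ := fun h0 => ht (by rw [h0]; simp)
          rw [hρ, (φ k).support_normed_eq] at this
          exact ball_subset_ball hk.le this
        filter_upwards [this] with t ht
        exact hball t ht
    _ = ε := by simp

end

section
open Filter Topology

variable {n : ℕ}

theorem entry_le_opNorm (M : Matrix (Fin n) (Fin n) ℝ) (i j : Fin n) : |M i j| ≤ opNorm M := by
  have h1 : Matrix.toEuclideanLin M (EuclideanSpace.single j 1) i = M i j := by
    simp [Matrix.toLpLin_apply]
  have h2 := (LinearMap.toContinuousLinearMap (Matrix.toEuclideanLin M)).le_opNorm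
    (EuclideanSpace.single j 1)
  rw [EuclideanSpace.norm_single, norm_one, mul_one] at h2
  have h3 := PiLp.norm_apply_le
    ((LinearMap.toContinuousLinearMap (Matrix.toEuclideanLin M)) (EuclideanSpace.single j 1)) i
  have h4 : (LinearMap.toContinuousLinearMap (Matrix.toEuclideanLin M))
    (EuclideanSpace.single j 1) i = M i j := h1
  rw [h4] at h3
  exact h3.trans h2

theorem lintegral_entry_lt_top {X : Set (Euc n)} {h : Euc n → Euc n}
    {Dh : Euc n → Matrix (Fin n) (Fin n) ℝ} (hS : MemSobolev (n : ℝ) X h Dh) (i j : Fin n) :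
    ∫⁻ x in X, ‖Dh x i j‖ₑ ^ n < ⊤ := by
  refine lt_of_le_of_lt (lintegral_mono fun x => ?_) hS.lp.2
  rw [← enorm_pow]
  refine enorm_le_iff_norm_le.2 ?_
  show ‖Dh x i j ^ n‖ ≤ ‖opNorm (Dh x) ^ (n : ℝ)‖
  rw [Real.rpow_natCast, norm_pow, norm_pow]
  gcongr
  rw [Real.norm_eq_abs, Real.norm_eq_abs]
  exact (entry_le_opNorm _ i j).trans (le_abs_self _)

theorem mollify {X : Set (Euc n)} (hX : IsOpen X) {h : Euc n → Euc n}
    {Dh : Euc n → Matrix (Fin n) (Fin n) ℝ} (hn : n ≠ 0) (hc : ContinuousOn h X)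
    (hS : MemSobolev (n : ℝ) X h Dh) (hm : ∀ i j, Measurable fun x => Dh x i j)
    {K : Set (Euc n)} (hK : IsCompact K) (hKX : K ⊆ X) :
    ∃ H : ℕ → Euc n → Euc n, (∀ k, ContDiff ℝ (⊤ : ℕ∞) (H k)) ∧ TendstoUniformlyOn H h atTop K ∧
      ∀ i j, Tendsto (fun k => ∫⁻ x in K, ‖jac (H k) x i j - Dh x i j‖ₑ ^ n) atTop (𝓝 0) := by
  obtain ⟨η, hη, hηX⟩ := hK.exists_cthickening_subset_open hX hKX
  set K' := cthickening η K with hK'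
  have hK'c : IsCompact K' := hK.cthickening
  have hK'm : MeasurableSet K' := hK'c.isClosed.measurableSet
  have hKK' : K ⊆ K' := self_subset_cthickening K
  have hballK : ∀ x ∈ K, closedBall x η ⊆ K' := fun x hx => closedBall_subset_cthickening hx η
  set v : Euc n → Euc n := K'.indicator h with hv
  have hvi : Integrable v := by
    rw [hv, integrable_indicator_iff hK'm]
    exact (hc.mono hηX).integrableOn_compact hK'c
  set r : ℕ → ℝ := fun k => η / (k + 2) with hr
  have hr0 : ∀ k, 0 < r k := fun k => by simp only [hr]; positivity
  have hrη : ∀ k, r k ≤ η := fun k => by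
    simp only [hr]
    exact div_le_self hη.le (by have : (0:ℝ) ≤ k := by positivity
                                linarith)
  have hrt : Tendsto r atTop (𝓝 0) :=
    tendsto_const_nhds.div_atTop (tendsto_atTop_add_const_right _ _ tendsto_natCast_atTop_atTop)
  set φ : ℕ → ContDiffBump (0 : Euc n) := fun k =>
    ⟨r k / 2, r k, half_pos (hr0 k), half_lt_self (hr0 k)⟩ with hφ
  set H : ℕ → Euc n → Euc n := fun k =>
    convolution ((φ k).normed volume) v (ContinuousLinearMap.lsmul ℝ ℝ) volume with hH
  have hρs : ∀ k, ContDiff ℝ (⊤ : ℕ∞) ((φ k).normed volume) := fun k => (φ k).contDiff_normed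
  have hρc : ∀ k, HasCompactSupport ((φ k).normed volume) := fun k => (φ k).hasCompactSupport_normed
  have hρt : ∀ k, tsupport ((φ k).normed volume) = closedBall 0 (r k) :=
    fun k => (φ k).tsupport_normed_eq
  refine ⟨H, fun k => (hρc k).contDiff_convolution_left _ (hρs k) hvi.locallyIntegrable, ?_, ?_⟩
  · rw [Metric.tendstoUniformlyOn_iff]
    intro ε hε
    have huc : UniformContinuousOn h K' :=
      hK'c.uniformContinuousOn_of_continuous (hc.mono hηX)
    obtain ⟨δ, hδ, hδh⟩ := Metric.uniformContinuousOn_iff.1 huc (ε / 2) (half_pos hε)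
    filter_upwards [hrt.eventually (gt_mem_nhds hδ)] with k hk x hx
    have hvx : v x = h x := indicator_of_mem (hKK' hx) h
    have := (φ k).dist_normed_convolution_le (x₀ := x) (ε := ε / 2) (g := v) (μ := volume)
      hvi.aestronglyMeasurable (fun z hz => by
        have hz' : dist z x < r k := hz
        have hzK : z ∈ K' := hballK x hx (mem_closedBall.2 (hz'.le.trans (hrη k)))
        rw [hvx, hv, indicator_of_mem hzK]
        exact (hδh z hzK x (hKK' hx) (hz'.trans hk)).le)
    rw [hvx, dist_comm] at this
    exact lt_of_le_of_lt this (half_lt_self hε)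
  · intro i j
    set w : Euc n → ℝ := K'.indicator (fun x => Dh x i j) with hw
    have hwm : Measurable w := (hm i j).indicator hK'm
    have hwL : MemLp w n volume := by
      refine ⟨hwm.aestronglyMeasurable, ?_⟩
      have h1 : eLpNorm w n volume ^ n < ⊤ := by
        rw [eLpNorm_natPow hn]
        have : ∀ x, ‖w x‖ₑ ^ n = K'.indicator (fun x => ‖Dh x i j‖ₑ ^ n) x := by
          intro x
          by_cases hx : x ∈ K' <;> simp [hw, hx, hn]
        simp_rw [this]
        rw [lintegral_indicator hK'm]
        exact (lintegral_mono_set hηX).trans_lt (lintegral_entry_lt_top hS i j)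
      by_contra hcon
      rw [not_lt, top_le_iff] at hcon
      rw [hcon, ENNReal.top_pow hn] at h1
      exact lt_irrefl _ h1
    have hconv := mollify_Lp hn hwm hwL φ hrt
    refine tendsto_of_tendsto_of_tendsto_of_le_of_le tendsto_const_nhds hconv
      (fun k => zero_le) fun k => ?_
    refine le_trans (le_of_eq ?_) (setLIntegral_le_lintegral K _)
    refine setLIntegral_congr_fun hK.measurableSet fun x hx => ?_
    have hwx : w x = Dh x i j := indicator_of_mem (hKK' hx) _
    suffices jac (H k) x i j = ∫ t, (φ k).normed volume t * w (x - t) by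
      simp only [this, hwx]
    set ρ := (φ k).normed volume with hρ
    have hd := (hρc k).hasFDerivAt_convolution_left (ContinuousLinearMap.lsmul ℝ ℝ)
      ((hρs k).of_le (by simp)) hvi.locallyIntegrable (x₀ := x)
    have hci : Integrable (fun t => ((ContinuousLinearMap.lsmul ℝ ℝ : ℝ →L[ℝ] Euc n →L[ℝ] Euc n).precompL (Euc n))
        (fderiv ℝ ρ t) (v (x - t))) :=
      ((hρc k).fderiv (𝕜 := ℝ)).convolutionExists_left _
        ((hρs k).continuous_fderiv (by simp)) hvi.locallyIntegrable x
    set ev : (Euc n →L[ℝ] Euc n) →L[ℝ] ℝ := (EuclideanSpace.proj i : Euc n →L[ℝ] ℝ).comp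
      (ContinuousLinearMap.apply ℝ (Euc n) (EuclideanSpace.single j (1:ℝ))) with hev
    have e1 : jac (H k) x i j = ∫ t, fderiv ℝ ρ t (EuclideanSpace.single j 1) * v (x - t) i := by
      rw [jac_apply, hH, hd.fderiv]
      have := ev.integral_comp_comm hci
      have h2 : ev ((convolution (fderiv ℝ ρ) v
        ((ContinuousLinearMap.lsmul ℝ ℝ : ℝ →L[ℝ] Euc n →L[ℝ] Euc n).precompL (Euc n)) volume) x) = ∫ t, fderiv ℝ ρ t (EuclideanSpace.single j 1) * v (x - t) i := by
        rw [convolution_def, ← this]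
        rfl
      exact h2
    rw [e1]
    have f1 := integral_sub_left_eq_self
      (fun t => fderiv ℝ ρ t (EuclideanSpace.single j 1) * v (x - t) i) volume x
    have f2 := integral_sub_left_eq_self (fun t => ρ t * w (x - t)) volume x
    rw [← f1, ← f2]
    simp only [sub_sub_cancel]
    set ψ : Euc n → ℝ := fun y => ρ (x - y) with hψ
    have hψs : ContDiff ℝ (⊤ : ℕ∞) ψ := (hρs k).comp (contDiff_const.sub contDiff_id)
    have hψt : tsupport ψ ⊆ closedBall x (r k) := by
      refine closure_minimal (fun y hy => ?_) isClosed_closedBall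
      have : x - y ∈ closedBall (0 : Euc n) (r k) := by
        rw [← hρt k]; exact subset_closure hy
      rw [mem_closedBall_zero_iff] at this
      rw [mem_closedBall, dist_comm, dist_eq_norm]; exact this
    have hψK : tsupport ψ ⊆ K' := hψt.trans ((closedBall_subset_closedBall (hrη k)).trans (hballK x hx))
    have hψc : HasCompactSupport ψ := (isCompact_closedBall x (r k)).of_isClosed_subset
      (isClosed_tsupport _) hψt
    have hψd : ∀ y, fderiv ℝ ψ y (EuclideanSpace.single j 1) =
        - fderiv ℝ ρ (x - y) (EuclideanSpace.single j 1) := by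
      intro y
      have h1 : HasFDerivAt ψ ((fderiv ℝ ρ (x - y)).comp (-ContinuousLinearMap.id ℝ (Euc n))) y :=
        ((hρs k).differentiable (by simp) (x - y)).hasFDerivAt.comp y
          ((hasFDerivAt_id y).const_sub x)
      rw [h1.fderiv]; simp
    have hp := hS.parts ψ hψs hψc (hψK.trans hηX) i j
    rw [setIntegral_eq_integral_of_forall_compl_eq_zero,
      setIntegral_eq_integral_of_forall_compl_eq_zero] at hp
    · have g1 : ∀ y, h y i * fderiv ℝ ψ y (EuclideanSpace.single j 1) =
          - (fderiv ℝ ρ (x - y) (EuclideanSpace.single j 1) * v y i) := by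
        intro y
        by_cases hy : y ∈ K'
        · rw [hψd, hv, indicator_of_mem hy]; ring
        · have h3 : fderiv ℝ ψ y = 0 :=
            image_eq_zero_of_notMem_tsupport fun hc => hy (hψK (tsupport_fderiv_subset ℝ hc))
          rw [hv, indicator_of_notMem hy, h3]; simp
      have g2 : ∀ y, Dh y i j * ψ y = ρ (x - y) * w y := by
        intro y
        by_cases hy : y ∈ K'
        · rw [hw, indicator_of_mem hy]; ring
        · have h3 : ψ y = 0 :=
            image_eq_zero_of_notMem_tsupport fun hc => hy (hψK hc)
          rw [hw, indicator_of_notMem hy, h3]; simp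
      simp_rw [g1, g2, integral_neg] at hp
      exact neg_injective hp
    · intro y hy
      have h3 : ψ y = 0 :=
        image_eq_zero_of_notMem_tsupport fun hc => hy (hηX (hψK hc))
      rw [h3, mul_zero]
    · intro y hy
      have h3 : fderiv ℝ ψ y = 0 :=
        image_eq_zero_of_notMem_tsupport fun hc => hy (hηX (hψK (tsupport_fderiv_subset ℝ hc)))
      rw [h3]; simp

end

section
open Filter Topology

variable {n : ℕ}

theorem hom_est {E : Type*} [NormedAddCommGroup E] [NormedSpace ℝ E] [FiniteDimensional ℝ E]
    {P : E → ℝ} (hP : Continuous P) {m N : ℕ} (hm : 1 ≤ m) (hmN : m ≤ N)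
    (hom : ∀ (t : ℝ) a, P (t • a) = t ^ m * P a) {δ : ℝ} (hδ : 0 < δ) :
    ∃ C : ℝ, 0 ≤ C ∧ ∀ b c : E, |P (b + c) - P b| ≤ δ * (1 + ‖b‖ ^ N) + C * ‖c‖ ^ N := by
  have : ProperSpace E := FiniteDimensional.proper ℝ E
  have hP0 : P 0 = 0 := by
    have := hom 0 0
    rw [zero_smul, zero_pow (by omega), zero_mul] at this
    exact this
  obtain ⟨M, hM⟩ : ∃ M, ∀ a ∈ closedBall (0 : E) 1, ‖P a‖ ≤ M :=
    (isCompact_closedBall 0 1).exists_bound_of_continuousOn hP.continuousOn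
  have hM0 : 0 ≤ M := (norm_nonneg _).trans (hM 0 (by simp))
  have hbd : ∀ a, |P a| ≤ M * ‖a‖ ^ m := by
    intro a
    by_cases ha : a = 0
    · rw [ha, hP0, abs_zero]; positivity
    · have hna : 0 < ‖a‖ := norm_pos_iff.2 ha
      have h1 : P a = ‖a‖ ^ m * P (‖a‖⁻¹ • a) := by
        rw [← hom, smul_smul, mul_inv_cancel₀ hna.ne', one_smul]
      rw [h1, abs_mul, abs_of_nonneg (by positivity), mul_comm]
      gcongr
      refine hM _ ?_
      rw [mem_closedBall_zero_iff, norm_smul, norm_inv, norm_norm, inv_mul_cancel₀ hna.ne']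
  have huc : UniformContinuousOn P (closedBall (0 : E) 2) :=
    (isCompact_closedBall 0 2).uniformContinuousOn_of_continuous hP.continuousOn
  obtain ⟨η0, hη0, hη⟩ := Metric.uniformContinuousOn_iff.1 huc δ hδ
  set η := min η0 1 with hηd
  have hηp : 0 < η := lt_min hη0 one_pos
  set Q := M * (1 + 1 / η) ^ m + M * (1 / η) ^ m with hQ
  have hQ0 : 0 ≤ Q := by positivity
  set τ := min 1 (δ / (Q + 1)) with hτ
  have hτ0 : 0 < τ := lt_min one_pos (by positivity)
  refine ⟨Q / τ ^ (N - m), by positivity, fun b c => ?_⟩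
  by_cases hcb : ‖c‖ < η * ‖b‖
  · have hb : 0 < ‖b‖ := by
      by_contra hcon
      have : ‖b‖ = 0 := le_antisymm (not_lt.1 hcon) (norm_nonneg _)
      rw [this, mul_zero] at hcb
      exact absurd hcb (not_lt.2 (norm_nonneg _))
    have e1 : ∀ a, P a = ‖b‖ ^ m * P (‖b‖⁻¹ • a) := fun a => by
      rw [← hom, smul_smul, mul_inv_cancel₀ hb.ne', one_smul]
    have hnc : ‖‖b‖⁻¹ • c‖ < η := by
      rw [norm_smul, norm_inv, norm_norm, inv_mul_lt_iff₀ hb, mul_comm]; exact hcb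
    have hnb : ‖‖b‖⁻¹ • b‖ = 1 := by
      rw [norm_smul, norm_inv, norm_norm, inv_mul_cancel₀ hb.ne']
    have h2 := hη (‖b‖⁻¹ • (b + c)) (by
      rw [mem_closedBall_zero_iff, smul_add]
      refine (norm_add_le _ _).trans ?_
      rw [hnb]
      linarith [min_le_right η0 1]) (‖b‖⁻¹ • b) (by
      rw [mem_closedBall_zero_iff, hnb]; norm_num) (by
      rw [dist_eq_norm, ← smul_sub, add_sub_cancel_left]
      exact hnc.trans_le (min_le_left _ _))
    rw [Real.dist_eq] at h2
    rw [e1 (b + c), e1 b, ← mul_sub, abs_mul, abs_of_nonneg (by positivity)]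
    have h3 : ‖b‖ ^ m ≤ 1 + ‖b‖ ^ N := by
      rcases le_total ‖b‖ 1 with h | h
      · have := pow_le_one₀ (n := m) hb.le h
        have : 0 ≤ ‖b‖ ^ N := by positivity
        linarith
      · have := pow_le_pow_right₀ h hmN
        linarith
    have h4 : 0 ≤ Q / τ ^ (N - m) * ‖c‖ ^ N := by positivity
    calc ‖b‖ ^ m * |P (‖b‖⁻¹ • (b + c)) - P (‖b‖⁻¹ • b)|
        ≤ (1 + ‖b‖ ^ N) * δ := by gcongr
      _ ≤ _ := by linarith
  · have hcb' : ‖b‖ ≤ 1 / η * ‖c‖ := by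
      rw [not_lt] at hcb
      rw [one_div, le_inv_mul_iff₀ hηp]; exact hcb
    have h1 : |P (b + c) - P b| ≤ Q * ‖c‖ ^ m := by
      have h2 : ‖b + c‖ ≤ (1 + 1 / η) * ‖c‖ := by
        linarith [norm_add_le b c]
      calc |P (b + c) - P b| ≤ |P (b + c)| + |P b| := abs_sub _ _
        _ ≤ M * ‖b + c‖ ^ m + M * ‖b‖ ^ m := add_le_add (hbd _) (hbd _)
        _ ≤ M * ((1 + 1 / η) * ‖c‖) ^ m + M * (1 / η * ‖c‖) ^ m := by gcongr
        _ = Q * ‖c‖ ^ m := by rw [hQ, mul_pow, mul_pow]; ring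
    refine h1.trans ?_
    have hb0 : 0 ≤ δ * ‖b‖ ^ N := by positivity
    rcases le_total ‖c‖ τ with hc | hc
    · have h5 : ‖c‖ ^ m ≤ τ := by
        calc ‖c‖ ^ m ≤ ‖c‖ ^ 1 :=
              pow_le_pow_of_le_one (norm_nonneg _) (hc.trans (min_le_left _ _)) hm
          _ ≤ τ := by rwa [pow_one]
      have h6 : Q * τ ≤ δ := by
        calc Q * τ ≤ Q * (δ / (Q + 1)) := by gcongr; exact min_le_right _ _
          _ ≤ (Q + 1) * (δ / (Q + 1)) := by gcongr; linarith
          _ = δ := by field_simp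
      have h7 : 0 ≤ Q / τ ^ (N - m) * ‖c‖ ^ N := by positivity
      have h8 : Q * ‖c‖ ^ m ≤ Q * τ := by gcongr
      linarith
    · have h5 : Q * ‖c‖ ^ m ≤ Q / τ ^ (N - m) * ‖c‖ ^ N := by
        have : ‖c‖ ^ N = ‖c‖ ^ m * ‖c‖ ^ (N - m) := by rw [← pow_add]; congr 1; omega
        rw [this, div_mul_eq_mul_div, le_div_iff₀ (by positivity)]
        calc Q * ‖c‖ ^ m * τ ^ (N - m) ≤ Q * ‖c‖ ^ m * ‖c‖ ^ (N - m) := by gcongr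
          _ = _ := by ring
      linarith

theorem pi_norm_pow_le {a : Fin n → Fin n → ℝ} {N : ℕ} (hN : N ≠ 0) :
    ‖a‖ ^ N ≤ ∑ i, ∑ j, ‖a i j‖ ^ N := by
  set S := ∑ i, ∑ j, ‖a i j‖ ^ N with hS
  have hS0 : 0 ≤ S := by positivity
  set R := S ^ (1 / (N : ℝ)) with hR
  have hR0 : 0 ≤ R := by positivity
  have hRN : R ^ N = S := by
    rw [hR, ← Real.rpow_natCast, ← Real.rpow_mul hS0]
    have : (1 / (N:ℝ)) * N = 1 := by field_simp
    rw [this, Real.rpow_one]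
  have : ‖a‖ ≤ R := by
    rw [pi_norm_le_iff_of_nonneg hR0]
    intro i
    rw [pi_norm_le_iff_of_nonneg hR0]
    intro j
    rw [← pow_le_pow_iff_left₀ (norm_nonneg _) hR0 hN, hRN, hS]
    refine le_trans ?_ (Finset.single_le_sum (f := fun i => ∑ j, ‖a i j‖ ^ N)
      (fun i _ => by positivity) (Finset.mem_univ i))
    exact Finset.single_le_sum (f := fun j => ‖a i j‖ ^ N)
      (fun i _ => by positivity) (Finset.mem_univ j)
  rw [← hRN]
  gcongr

theorem tendsto_hom {α : Type*} [MeasurableSpace α] {μ : Measure α} [IsFiniteMeasure μ]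
    {P : (Fin n → Fin n → ℝ) → ℝ} (hP : Continuous P) {m N : ℕ} (hm : 1 ≤ m) (hmN : m ≤ N)
    (hom : ∀ (t : ℝ) a, P (t • a) = t ^ m * P a)
    {A : ℕ → α → Fin n → Fin n → ℝ} {B : α → Fin n → Fin n → ℝ}
    (hA : ∀ k i j, Measurable fun x => A k x i j) (hB : ∀ i j, Measurable fun x => B x i j)
    (hBf : ∀ i j, ∫⁻ x, ‖B x i j‖ₑ ^ N ∂μ < ⊤)
    (hAB : ∀ i j, Tendsto (fun k => ∫⁻ x, ‖A k x i j - B x i j‖ₑ ^ N ∂μ) atTop (𝓝 0)) :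
    Tendsto (fun k => ∫⁻ x, ‖P (A k x) - P (B x)‖ₑ ∂μ) atTop (𝓝 0) := by
  have hN : N ≠ 0 := by omega
  set SB := ∑ i, ∑ j, ∫⁻ x, ‖B x i j‖ₑ ^ N ∂μ with hSB
  have hSBf : SB < ⊤ := ENNReal.sum_lt_top.2 fun i _ => ENNReal.sum_lt_top.2 fun j _ => hBf i j
  set T : ℕ → ℝ≥0∞ := fun k => ∑ i, ∑ j, ∫⁻ x, ‖A k x i j - B x i j‖ₑ ^ N ∂μ with hT
  have hT0 : Tendsto T atTop (𝓝 0) := by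
    have := tendsto_finsetSum Finset.univ fun i (_ : i ∈ Finset.univ) =>
      tendsto_finsetSum Finset.univ fun j (_ : j ∈ Finset.univ) => hAB i j
    simpa using this
  have hpow : ∀ a : Fin n → Fin n → ℝ, ‖a‖ₑ ^ N ≤ ∑ i, ∑ j, ‖a i j‖ₑ ^ N := by
    intro a
    have h1 : ‖a‖ₑ ^ N = ENNReal.ofReal (‖a‖ ^ N) := by
      rw [← ofReal_norm, ENNReal.ofReal_pow (norm_nonneg _)]
    rw [h1]
    refine (ENNReal.ofReal_le_ofReal (pi_norm_pow_le hN)).trans_eq ?_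
    rw [ENNReal.ofReal_sum_of_nonneg (fun i _ => by positivity)]
    refine Finset.sum_congr rfl fun i _ => ?_
    rw [ENNReal.ofReal_sum_of_nonneg (fun i _ => by positivity)]
    refine Finset.sum_congr rfl fun j _ => ?_
    rw [← ofReal_norm, ENNReal.ofReal_pow (norm_nonneg _)]
  have est : ∀ δ : ℝ, 0 < δ → ∃ C : ℝ, ∀ k, ∫⁻ x, ‖P (A k x) - P (B x)‖ₑ ∂μ ≤
      ENNReal.ofReal δ * (μ univ + SB) + ENNReal.ofReal C * T k := by
    intro δ hδ
    obtain ⟨C, hC0, hC⟩ := hom_est hP hm hmN hom hδ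
    refine ⟨C, fun k => ?_⟩
    have hpt : ∀ x, ‖P (A k x) - P (B x)‖ₑ ≤
        ENNReal.ofReal δ * (1 + ∑ i, ∑ j, ‖B x i j‖ₑ ^ N) +
        ENNReal.ofReal C * ∑ i, ∑ j, ‖A k x i j - B x i j‖ₑ ^ N := by
      intro x
      have h1 := hC (B x) (A k x - B x)
      rw [add_sub_cancel] at h1
      rw [← ofReal_norm, Real.norm_eq_abs]
      refine (ENNReal.ofReal_le_ofReal h1).trans ?_
      rw [ENNReal.ofReal_add (by positivity) (by positivity), ENNReal.ofReal_mul hδ.le,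
        ENNReal.ofReal_mul hC0, ENNReal.ofReal_add zero_le_one (by positivity), ENNReal.ofReal_one,
        ENNReal.ofReal_pow (norm_nonneg _), ENNReal.ofReal_pow (norm_nonneg _),
        ofReal_norm, ofReal_norm]
      gcongr
      · exact hpow _
      · exact hpow (A k x - B x)
    refine (lintegral_mono hpt).trans_eq ?_
    have mB : ∀ i j, Measurable fun x => ‖B x i j‖ₑ ^ N := fun i j => (hB i j).enorm.pow_const N
    have mAB : ∀ i j, Measurable fun x => ‖A k x i j - B x i j‖ₑ ^ N := fun i j =>
      ((hA k i j).sub (hB i j)).enorm.pow_const N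
    have mB' : Measurable fun x => ∑ i, ∑ j, ‖B x i j‖ₑ ^ N :=
      Finset.measurable_fun_sum _ fun i _ => Finset.measurable_fun_sum _ fun j _ => mB i j
    have mAB' : Measurable fun x => ∑ i, ∑ j, ‖A k x i j - B x i j‖ₑ ^ N :=
      Finset.measurable_fun_sum _ fun i _ => Finset.measurable_fun_sum _ fun j _ => mAB i j
    have mB1 : Measurable fun x => (1 : ℝ≥0∞) + ∑ i, ∑ j, ‖B x i j‖ₑ ^ N :=
      measurable_const.add mB'
    rw [lintegral_add_right _ (mAB'.const_mul _), lintegral_const_mul _ mAB',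
      lintegral_const_mul _ mB1, lintegral_add_right _ mB',
      lintegral_finsetSum _ fun i _ => Finset.measurable_fun_sum _ fun j _ => mB i j,
      lintegral_finsetSum _ fun i _ => Finset.measurable_fun_sum _ fun j _ => mAB i j]
    simp only [lintegral_finsetSum _ fun j _ => mB _ j, lintegral_finsetSum _ fun j _ => mAB _ j]
    simp [hSB, hT]
  rw [ENNReal.tendsto_nhds_zero]
  intro ε hε
  have hfin : μ univ + SB < ⊤ := ENNReal.add_lt_top.2 ⟨measure_lt_top _ _, hSBf⟩
  obtain ⟨δ, hδ, hδε⟩ : ∃ δ : ℝ, 0 < δ ∧ ENNReal.ofReal δ * (μ univ + SB) ≤ ε / 2 := by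
    have h1 : Tendsto (fun δ : ℝ => ENNReal.ofReal δ * (μ univ + SB)) (𝓝[>] 0) (𝓝 0) := by
      have h2 : Tendsto (fun δ : ℝ => ENNReal.ofReal δ) (𝓝[>] 0) (𝓝 0) := by
        have := (ENNReal.continuous_ofReal.tendsto 0).mono_left (nhdsWithin_le_nhds (s := Ioi (0:ℝ)))
        simpa using this
      have := ENNReal.Tendsto.mul_const h2 (b := μ univ + SB) (Or.inr hfin.ne)
      simpa using this
    have h3 := (ENNReal.tendsto_nhds_zero.1 h1 (ε / 2) (ENNReal.half_pos hε.ne')).and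
      (self_mem_nhdsWithin (s := Ioi (0:ℝ)) (a := 0))
    obtain ⟨δ, h4, h5⟩ := h3.exists
    exact ⟨δ, h5, h4⟩
  obtain ⟨C, hC⟩ := est δ hδ
  have h1 : Tendsto (fun k => ENNReal.ofReal C * T k) atTop (𝓝 0) := by
    have := ENNReal.Tendsto.const_mul hT0 (a := ENNReal.ofReal C) (Or.inr ENNReal.ofReal_ne_top)
    simpa using this
  filter_upwards [ENNReal.tendsto_nhds_zero.1 h1 (ε / 2) (ENNReal.half_pos hε.ne')] with k hk
  calc _ ≤ _ := hC k
    _ ≤ ε / 2 + ε / 2 := add_le_add hδε hk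
    _ = ε := ENNReal.add_halves ε

/-- passing to the limit in products -/
theorem tendsto_int_mul {K : Set (Euc n)} (hK : MeasurableSet K) {w : Euc n → ℝ}
    {wk : ℕ → Euc n → ℝ} (hw : IntegrableOn w K) (hwk : ∀ k, IntegrableOn (wk k) K)
    (hlim : Tendsto (fun k => ∫⁻ x in K, ‖wk k x - w x‖ₑ) atTop (𝓝 0))
    {g : Euc n → ℝ} {gk : ℕ → Euc n → ℝ} (hgm : ∀ k, AEStronglyMeasurable (gk k) (volume.restrict K))
    (hg : TendstoUniformlyOn gk g atTop K) {G : ℝ} (hG : ∀ x ∈ K, |g x| ≤ G) :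
    Tendsto (fun k => ∫ x in K, gk k x * wk k x) atTop (𝓝 (∫ x in K, g x * w x)) := by
  have hbd : ∀ᶠ k in atTop, ∀ x ∈ K, |gk k x| ≤ G + 1 := by
    filter_upwards [Metric.tendstoUniformlyOn_iff.1 hg 1 one_pos] with k hk x hx
    have h1 := hk x hx
    rw [Real.dist_eq, abs_sub_comm] at h1
    have := abs_sub_abs_le_abs_sub (gk k x) (g x)
    linarith [hG x hx]
  have hbd' : ∀ᶠ k in atTop, ∀ᵐ x ∂(volume.restrict K), |gk k x| ≤ G + 1 := by
    filter_upwards [hbd] with k hk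
    exact (ae_restrict_iff' hK).2 (Eventually.of_forall hk)
  have t2 : Tendsto (fun k => ∫ x in K, gk k x * w x) atTop (𝓝 (∫ x in K, g x * w x)) := by
    refine tendsto_integral_filter_of_dominated_convergence (fun x => (G + 1) * |w x|) ?_ ?_ ?_ ?_
    · exact Eventually.of_forall fun k => (hgm k).mul hw.aestronglyMeasurable
    · filter_upwards [hbd'] with k hk
      filter_upwards [hk] with x hx
      rw [norm_mul]
      exact mul_le_mul_of_nonneg_right hx (norm_nonneg _)
    · exact (hw.abs).const_mul _
    · refine (ae_restrict_iff' hK).2 (Eventually.of_forall fun x hx => ?_)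
      exact (hg.tendsto_at hx).mul_const _
  have t1 : Tendsto (fun k => ∫ x in K, gk k x * (wk k x - w x)) atTop (𝓝 0) := by
    rw [tendsto_zero_iff_enorm_tendsto_zero]
    have h0 : Tendsto (fun k => ENNReal.ofReal (G + 1) * ∫⁻ x in K, ‖wk k x - w x‖ₑ) atTop (𝓝 0) := by
      have := ENNReal.Tendsto.const_mul hlim (a := ENNReal.ofReal (G + 1))
        (Or.inr ENNReal.ofReal_ne_top)
      simpa using this
    refine tendsto_of_tendsto_of_tendsto_of_le_of_le' tendsto_const_nhds h0
      (Eventually.of_forall fun k => zero_le) ?_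
    filter_upwards [hbd'] with k hk
    refine (enorm_integral_le_lintegral_enorm _).trans ?_
    rw [← lintegral_const_mul' _ _ ENNReal.ofReal_ne_top]
    refine lintegral_mono_ae ?_
    filter_upwards [hk] with x hx
    rw [enorm_mul]
    gcongr
    rw [← ofReal_norm]
    exact ENNReal.ofReal_le_ofReal hx
  have := t1.add t2
  rw [zero_add] at this
  refine this.congr' ?_
  filter_upwards [hbd'] with k hk
  have i1 : Integrable (fun x => gk k x * (wk k x - w x)) (volume.restrict K) :=
    ((hwk k).sub hw).bdd_mul (hgm k) (c := G + 1) hk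
  have i2 : Integrable (fun x => gk k x * w x) (volume.restrict K) :=
    hw.bdd_mul (hgm k) (c := G + 1) hk
  rw [← integral_add i1 i2]
  congr 1
  ext x
  ring

end

section
open Filter Topology
variable {n : ℕ}

theorem cont_det_of : Continuous fun a : Fin n → Fin n → ℝ => (Matrix.of a).det := by
  simp_rw [Matrix.det_apply', Matrix.of_apply]
  fun_prop

theorem cont_adj_of (i j : Fin n) :
    Continuous fun a : Fin n → Fin n → ℝ => (Matrix.of a).adjugate i j := by
  have : Continuous fun a : Fin n → Fin n → ℝ => (Matrix.of a).adjugate :=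
    Continuous.matrix_adjugate (continuous_id)
  exact (continuous_apply_apply i j).comp this

theorem det_of_hom (t : ℝ) (a : Fin n → Fin n → ℝ) :
    (Matrix.of (t • a)).det = t ^ n * (Matrix.of a).det := by
  have : Matrix.of (t • a) = t • Matrix.of a := rfl
  rw [this, Matrix.det_smul, Fintype.card_fin]

theorem adj_of_hom (i j : Fin n) (t : ℝ) (a : Fin n → Fin n → ℝ) :
    (Matrix.of (t • a)).adjugate i j = t ^ (n - 1) * (Matrix.of a).adjugate i j := by
  have : Matrix.of (t • a) = t • Matrix.of a := rfl
  rw [this, Matrix.adjugate_smul, Fintype.card_fin, Matrix.smul_apply, smul_eq_mul]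

theorem measurable_hom {α : Type*} [MeasurableSpace α] {P : (Fin n → Fin n → ℝ) → ℝ}
    (hP : Continuous P) {B : α → Fin n → Fin n → ℝ} (hB : ∀ i j, Measurable fun x => B x i j) :
    Measurable fun x => P (B x) :=
  hP.measurable.comp (measurable_pi_iff.2 fun i => measurable_pi_iff.2 fun j => hB i j)

theorem lintegral_hom_lt_top {α : Type*} [MeasurableSpace α] {μ : Measure α} [IsFiniteMeasure μ]
    {P : (Fin n → Fin n → ℝ) → ℝ} (hP : Continuous P) {m N : ℕ} (hm : 1 ≤ m) (hmN : m ≤ N)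
    (hom : ∀ (t : ℝ) a, P (t • a) = t ^ m * P a)
    {B : α → Fin n → Fin n → ℝ} (hB : ∀ i j, Measurable fun x => B x i j)
    (hBf : ∀ i j, ∫⁻ x, ‖B x i j‖ₑ ^ N ∂μ < ⊤) : Integrable (fun x => P (B x)) μ := by
  refine ⟨(measurable_hom hP hB).aestronglyMeasurable, ?_⟩
  obtain ⟨C, hC0, hC⟩ := hom_est hP hm hmN hom one_pos
  have hN : N ≠ 0 := by omega
  have hP0 : P 0 = 0 := by
    have := hom 0 0
    rw [zero_smul, zero_pow (by omega), zero_mul] at this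
    exact this
  have hpt : ∀ x, ‖P (B x)‖ₑ ≤ 1 + ENNReal.ofReal C * ∑ i, ∑ j, ‖B x i j‖ₑ ^ N := by
    intro x
    have h1 := hC 0 (B x)
    rw [zero_add, hP0, sub_zero, norm_zero, zero_pow hN, add_zero, mul_one] at h1
    have h2 : |P (B x)| ≤ 1 + C * ∑ i, ∑ j, ‖B x i j‖ ^ N :=
      h1.trans (by gcongr; exact pi_norm_pow_le hN)
    rw [← ofReal_norm, Real.norm_eq_abs]
    refine (ENNReal.ofReal_le_ofReal h2).trans_eq ?_
    rw [ENNReal.ofReal_add zero_le_one (by positivity), ENNReal.ofReal_one,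
      ENNReal.ofReal_mul hC0, ENNReal.ofReal_sum_of_nonneg (fun i _ => by positivity)]
    congr 2
    refine Finset.sum_congr rfl fun i _ => ?_
    rw [ENNReal.ofReal_sum_of_nonneg (fun i _ => by positivity)]
    refine Finset.sum_congr rfl fun j _ => ?_
    rw [← ofReal_norm, ENNReal.ofReal_pow (norm_nonneg _)]
  refine (lintegral_mono hpt).trans_lt ?_
  rw [lintegral_add_left measurable_const, lintegral_const_mul' _ _ ENNReal.ofReal_ne_top,
    lintegral_finsetSum _ fun i _ => Finset.measurable_fun_sum _ fun j _ =>
      ((hB i j).enorm.pow_const N)]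
  refine ENNReal.add_lt_top.2 ⟨?_, ENNReal.mul_lt_top ENNReal.ofReal_lt_top ?_⟩
  · simp [measure_lt_top]
  · refine ENNReal.sum_lt_top.2 fun i _ => ?_
    rw [lintegral_finsetSum _ fun j _ => (hB i j).enorm.pow_const N]
    exact ENNReal.sum_lt_top.2 fun j _ => hBf i j

theorem det_integrableOn (hn : 2 ≤ n) {X : Set (Euc n)} {h : Euc n → Euc n}
    {Dh : Euc n → Matrix (Fin n) (Fin n) ℝ} (hS : MemSobolev (n : ℝ) X h Dh)
    (hm : ∀ i j, Measurable fun x => Dh x i j) {K : Set (Euc n)} (hK : IsCompact K)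
    (hKX : K ⊆ X) : IntegrableOn (fun x => (Dh x).det) K := by
  have : IsFiniteMeasure (volume.restrict K) := ⟨by simpa using hK.measure_lt_top⟩
  exact lintegral_hom_lt_top (B := fun x => Dh x) cont_det_of (by omega) le_rfl det_of_hom hm
    fun i j => (lintegral_mono_set hKX).trans_lt (lintegral_entry_lt_top hS i j)

theorem adj_integrableOn (hn : 2 ≤ n) {X : Set (Euc n)} {h : Euc n → Euc n}
    {Dh : Euc n → Matrix (Fin n) (Fin n) ℝ} (hS : MemSobolev (n : ℝ) X h Dh)
    (hm : ∀ i j, Measurable fun x => Dh x i j) {K : Set (Euc n)} (hK : IsCompact K)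
    (hKX : K ⊆ X) (i j : Fin n) : IntegrableOn (fun x => (Dh x).adjugate i j) K := by
  have : IsFiniteMeasure (volume.restrict K) := ⟨by simpa using hK.measure_lt_top⟩
  exact lintegral_hom_lt_top (B := fun x => Dh x) (cont_adj_of i j) (m := n - 1) (by omega)
    (Nat.sub_le n 1) (adj_of_hom i j) hm
    fun i j => (lintegral_mono_set hKX).trans_lt (lintegral_entry_lt_top hS i j)

theorem approx (hn : 2 ≤ n) {X : Set (Euc n)} (hX : IsOpen X) {h : Euc n → Euc n}
    (hc : ContinuousOn h X)
    {Dh : Euc n → Matrix (Fin n) (Fin n) ℝ} (hS : MemSobolev (n : ℝ) X h Dh)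
    (hm : ∀ i j, Measurable fun x => Dh x i j) {K : Set (Euc n)} (hK : IsCompact K)
    (hKX : K ⊆ X) : ∃ H : ℕ → Euc n → Euc n, (∀ k, ContDiff ℝ (⊤ : ℕ∞) (H k)) ∧
      TendstoUniformlyOn H h atTop K ∧
      Tendsto (fun k => ∫⁻ x in K, ‖(jac (H k) x).det - (Dh x).det‖ₑ) atTop (𝓝 0) ∧
      ∀ i j, Tendsto (fun k => ∫⁻ x in K, ‖(jac (H k) x).adjugate i j - (Dh x).adjugate i j‖ₑ)
        atTop (𝓝 0) := by
  obtain ⟨H, h1, h2, h3⟩ := mollify hX (by omega) hc hS hm hK hKX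
  have : IsFiniteMeasure (volume.restrict K) := ⟨by simpa using hK.measure_lt_top⟩
  have hBf : ∀ i j, ∫⁻ x in K, ‖Dh x i j‖ₑ ^ n < ⊤ :=
    fun i j => (lintegral_mono_set hKX).trans_lt (lintegral_entry_lt_top hS i j)
  have hA : ∀ k i j, Measurable fun x => jac (H k) x i j := fun k i j =>
    (jac_entry_contDiff (h1 k) i j).continuous.measurable
  refine ⟨H, h1, h2, ?_, fun i j => ?_⟩
  · exact tendsto_hom (A := fun k x => jac (H k) x) (B := fun x => Dh x) cont_det_of (by omega)
      le_rfl det_of_hom hA hm hBf h3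
  · exact tendsto_hom (A := fun k x => jac (H k) x) (B := fun x => Dh x) (cont_adj_of i j)
      (m := n - 1) (by omega) (Nat.sub_le n 1) (adj_of_hom i j) hA hm hBf h3

end

section
open Filter Topology
variable {n : ℕ}

theorem smooth_exhaust {U : Set (Euc n)} (hU : IsOpen U) :
    ∃ g : ℕ → Euc n → ℝ, (∀ k, ContDiff ℝ (⊤ : ℕ∞) (g k)) ∧ (∀ k y, 0 ≤ g k y ∧ g k y ≤ 1) ∧
      (∀ k y, y ∉ U → g k y = 0) ∧ (∀ y, Monotone fun k => g k y) ∧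
      ∀ y, Tendsto (fun k => g k y) atTop (𝓝 (U.indicator (fun _ => 1) y)) := by
  obtain ⟨φ, h1, h2, h3⟩ := hU.exists_contDiff_support_eq (n := (⊤ : ℕ∞))
  have hr : ∀ y, 0 ≤ φ y ∧ φ y ≤ 1 := fun y => h3 (mem_range_self y)
  have hz : ∀ y, y ∉ U → φ y = 0 := fun y hy => by
    rw [← h1, Function.notMem_support] at hy; exact hy
  have hnz : ∀ y, y ∈ U → 0 < φ y := fun y hy => by
    rw [← h1, Function.mem_support] at hy
    exact lt_of_le_of_ne (hr y).1 hy.symm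
  refine ⟨fun k y => 1 - (1 - φ y) ^ k, fun k => ?_, fun k y => ⟨?_, ?_⟩, fun k y hy => ?_,
    fun y => ?_, fun y => ?_⟩
  · exact contDiff_const.sub ((contDiff_const.sub h2).pow k)
  · have := pow_le_one₀ (n := k) (sub_nonneg.2 (hr y).2) (by linarith [(hr y).1])
    linarith
  · have := pow_nonneg (sub_nonneg.2 (hr y).2) k
    linarith
  · simp [hz y hy]
  · intro a b hab
    have := pow_le_pow_of_le_one (sub_nonneg.2 (hr y).2) (by linarith [(hr y).1]) hab
    dsimp only
    linarith
  · by_cases hy : y ∈ U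
    · rw [indicator_of_mem hy]
      have := tendsto_pow_atTop_nhds_zero_of_lt_one (sub_nonneg.2 (hr y).2)
        (by linarith [hnz y hy] : 1 - φ y < 1)
      simpa using tendsto_const_nhds (x := (1:ℝ)).sub this
    · rw [indicator_of_notMem hy]
      simp [hz y hy]

theorem local_deg (hn : 2 ≤ n) {X Y : Set (Euc n)} (hX : IsOpen X) (hY : IsOpen Y)
    {h f : Euc n → Euc n} (hhf : IsHomeoOn h f X Y)
    {Dh : Euc n → Matrix (Fin n) (Fin n) ℝ} (hS : MemSobolev (n : ℝ) X h Dh)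
    (hm : ∀ i j, Measurable fun x => Dh x i j)
    (hJ : ∀ᵐ x ∂(volume.restrict X), 0 ≤ (Dh x).det) {x0 : Euc n} (hx0 : x0 ∈ X) :
    ∃ ρ > 0, closedBall (h x0) ρ ⊆ Y ∧ ∀ g : Euc n → ℝ, ContDiff ℝ (⊤ : ℕ∞) g →
      (∀ y, 0 ≤ g y) → tsupport g ⊆ ball (h x0) ρ →
      IntegrableOn (fun x => g (h x) * (Dh x).det) X ∧
      ∫ x in X, g (h x) * (Dh x).det = ∫ y, g y := by
  obtain ⟨r, hr, hrX, ρ, hρ, hρY, hfr, δ, hδ, hdeg⟩ := top_deg hX hY hhf hx0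
  refine ⟨ρ, hρ, hρY, fun g hg hg0 hgs => ?_⟩
  have hK := isCompact_closedBall x0 r
  obtain ⟨H, hH, hu, hdet, -⟩ := approx hn hX hhf.continuousOn hS hm hK hrX
  have hgc : HasCompactSupport g :=
    HasCompactSupport.of_support_subset_isCompact (isCompact_closedBall (h x0) ρ)
      ((subset_tsupport g).trans (hgs.trans ball_subset_closedBall))
  have hguc : UniformContinuous g := hgc.uniformContinuous_of_continuous hg.continuous
  obtain ⟨G, hG⟩ := hgc.exists_bound_of_continuous hg.continuous
  have hbX : ball x0 r ⊆ X := ball_subset_closedBall.trans hrX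
  have hdi := det_integrableOn hn hS hm hK hrX
  have hlim : Tendsto (fun k => ∫ x in ball x0 r, g (H k x) * (jac (H k) x).det) atTop
      (𝓝 (∫ x in ball x0 r, g (h x) * (Dh x).det)) := by
    refine tendsto_int_mul measurableSet_ball (hdi.mono_set ball_subset_closedBall) ?_ ?_ ?_ ?_
      (G := G) ?_
    · intro k
      exact ((jac_det_continuous (hH k)).continuousOn.integrableOn_compact hK).mono_set
        ball_subset_closedBall
    · exact tendsto_of_tendsto_of_tendsto_of_le_of_le tendsto_const_nhds hdet
        (fun k => zero_le) fun k => lintegral_mono_set ball_subset_closedBall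
    · exact fun k => (hg.continuous.comp (hH k).continuous).aestronglyMeasurable
    · exact hguc.comp_tendstoUniformlyOn (hu.mono ball_subset_closedBall)
    · exact fun x _ => hG _
  have hnn : 0 ≤ ∫ x in ball x0 r, g (h x) * (Dh x).det := by
    refine integral_nonneg_of_ae ?_
    filter_upwards [ae_mono (Measure.restrict_mono hbX le_rfl) hJ] with x hx
    exact mul_nonneg (hg0 _) hx
  have hev : ∀ᶠ k in atTop, |∫ x in ball x0 r, g (H k x) * (jac (H k) x).det| = ∫ y, g y := by
    filter_upwards [Metric.tendstoUniformlyOn_iff.1 hu δ hδ] with k hk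
    obtain ⟨c, hc, hcg⟩ := hdeg (H k) (hH k) fun x hx => by rw [dist_comm]; exact hk x hx
    have h1 := hcg g hg hgs
    rw [degL] at h1
    rw [h1, abs_mul, abs_of_nonneg (integral_nonneg hg0)]
    rcases hc with rfl | rfl <;> simp
  have hz : ∀ x ∈ X, x ∉ ball x0 r → g (h x) * (Dh x).det = 0 := by
    intro x hxX hx
    have : h x ∉ tsupport g := fun hc => hx (by
      have := hfr (h x) (ball_subset_closedBall (hgs hc))
      rwa [hhf.left_inv x hxX] at this)
    rw [image_eq_zero_of_notMem_tsupport this, zero_mul]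
  have hcont : ContinuousOn (fun x => g (h x)) X := hg.continuous.comp_continuousOn hhf.continuousOn
  have hib : IntegrableOn (fun x => g (h x) * (Dh x).det) (ball x0 r) := by
    refine Integrable.bdd_mul (c := G) (hdi.mono_set ball_subset_closedBall) ?_ ?_
    · exact (hcont.mono hbX).aestronglyMeasurable measurableSet_ball
    · exact Eventually.of_forall fun x => hG _
  constructor
  · rw [← sdiff_union_of_subset hbX]
    refine IntegrableOn.union ?_ hib
    refine integrableOn_zero.congr_fun (fun x hx => (hz x hx.1 hx.2).symm)
      (hX.measurableSet.diff measurableSet_ball)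
  · have h1 := tendsto_nhds_unique (hlim.abs) (tendsto_const_nhds.congr'
      (hev.mono fun k hk => hk.symm))
    rw [abs_of_nonneg hnn] at h1
    rw [← h1]
    exact (setIntegral_eq_of_subset_of_forall_sdiff_eq_zero hX.measurableSet hbX
      (fun x hx => hz x hx.1 hx.2))

theorem change_var (hn : 2 ≤ n) {X Y : Set (Euc n)} (hX : IsOpen X) (hY : IsOpen Y)
    {h f : Euc n → Euc n} (hhf : IsHomeoOn h f X Y) (hmh : Measurable h)
    {Dh : Euc n → Matrix (Fin n) (Fin n) ℝ} (hS : MemSobolev (n : ℝ) X h Dh)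
    (hm : ∀ i j, Measurable fun x => Dh x i j)
    (hJ : ∀ᵐ x ∂(volume.restrict X), 0 ≤ (Dh x).det) :
    Measure.map h ((volume.restrict X).withDensity fun x => ENNReal.ofReal (Dh x).det)
      = volume.restrict Y := by
  set ν := (volume.restrict X).withDensity fun x => ENNReal.ofReal (Dh x).det with hν
  set μ := Measure.map h ν with hμ
  have hmd : Measurable fun x => ENNReal.ofReal (Dh x).det :=
    (measurable_hom (B := fun x => Dh x) cont_det_of hm).ennreal_ofReal
  have hnu : ∀ g : Euc n → ℝ≥0∞, Measurable g →
      ∫⁻ y, g y ∂μ = ∫⁻ x in X, g (h x) * ENNReal.ofReal (Dh x).det := by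
    intro g hg
    have hgh : Measurable fun x => g (h x) := hg.comp hmh
    rw [hμ, lintegral_map hg hmh, hν, lintegral_withDensity_eq_lintegral_mul _ hmd hgh]
    refine lintegral_congr fun x => ?_
    simp [mul_comm]
  have hloc : ∀ y ∈ Y, ∃ ρ > 0, ball y ρ ⊆ Y ∧ μ.restrict (ball y ρ) = volume.restrict (ball y ρ) := by
    intro y hy
    obtain ⟨ρ, hρ, hρY, hg⟩ := local_deg hn hX hY hhf hS hm hJ (hhf.mapsTo_inv hy)
    rw [hhf.right_inv y hy] at hρY hg
    refine ⟨ρ / 2, by positivity, (ball_subset_ball (by linarith)).trans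
      (ball_subset_closedBall.trans hρY), ?_⟩
    have hop : ∀ U, IsOpen U → U ⊆ ball y (ρ / 2) → μ U = volume U := by
      intro U hU hUB
      obtain ⟨g, g1, g2, g3, g4, g5⟩ := smooth_exhaust hU
      have key : ∀ m : Measure (Euc n), Tendsto (fun k => ∫⁻ y, ENNReal.ofReal (g k y) ∂m) atTop
          (𝓝 (m U)) := by
        intro m
        have h1 := lintegral_tendsto_of_tendsto_of_monotone (μ := m)
          (f := fun k y => ENNReal.ofReal (g k y))
          (F := fun y => ENNReal.ofReal (U.indicator (fun _ => 1) y))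
          (fun k => ((g1 k).continuous.measurable.ennreal_ofReal).aemeasurable)
          (Eventually.of_forall fun y a b hab => ENNReal.ofReal_le_ofReal (g4 y hab))
          (Eventually.of_forall fun y => (ENNReal.continuous_ofReal.tendsto _).comp (g5 y))
        have h2 : ∫⁻ y, ENNReal.ofReal (U.indicator (fun _ => 1) y) ∂m = m U := by
          rw [← lintegral_indicator_one hU.measurableSet]
          refine lintegral_congr fun y => ?_
          by_cases hy : y ∈ U <;> simp [hy]
        rwa [h2] at h1
      refine tendsto_nhds_unique (key μ) ((key volume).congr fun k => ?_)
      have hts : tsupport (g k) ⊆ ball y ρ := by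
        have : Function.support (g k) ⊆ closedBall y (ρ / 2) := fun z hz => by
          by_contra hc
          exact hz (g3 k z fun hzU => hc (ball_subset_closedBall (hUB hzU)))
        exact (closure_minimal this isClosed_closedBall).trans
          (closedBall_subset_ball (by linarith))
      obtain ⟨i1, i2⟩ := hg (g k) (g1 k) (fun z => (g2 k z).1) hts
      rw [hnu _ (g1 k).continuous.measurable.ennreal_ofReal]
      have hgc : HasCompactSupport (g k) :=
        HasCompactSupport.of_support_subset_isCompact (isCompact_closedBall y ρ)
          ((subset_tsupport (g k)).trans (hts.trans ball_subset_closedBall))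
      rw [← ofReal_integral_eq_lintegral_ofReal ((g1 k).continuous.integrable_of_hasCompactSupport hgc)
        (Eventually.of_forall fun z => (g2 k z).1), ← i2, ofReal_integral_eq_lintegral_ofReal i1]
      · refine lintegral_congr fun x => ?_
        rw [ENNReal.ofReal_mul (g2 k _).1]
      · filter_upwards [hJ] with x hx
        exact mul_nonneg (g2 k _).1 hx
    have hfin : IsFiniteMeasure (μ.restrict (ball y (ρ / 2))) := ⟨by
      rw [Measure.restrict_apply_univ, hop _ isOpen_ball Subset.rfl]
      exact measure_ball_lt_top⟩
    refine ext_of_generate_finite _ (BorelSpace.measurable_eq) isPiSystem_isOpen ?_ ?_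
    · intro s hs
      have hs' : IsOpen s := hs
      rw [Measure.restrict_apply hs'.measurableSet, Measure.restrict_apply hs'.measurableSet]
      exact hop _ (IsOpen.inter hs' isOpen_ball) inter_subset_right
    · rw [Measure.restrict_apply_univ, Measure.restrict_apply_univ]
      exact hop _ isOpen_ball Subset.rfl
  have hYc : μ Yᶜ = 0 := by
    rw [hμ, Measure.map_apply hmh hY.measurableSet.compl, hν,
      withDensity_apply _ (hmh hY.measurableSet.compl),
      Measure.restrict_restrict (hmh hY.measurableSet.compl)]
    have : h ⁻¹' Yᶜ ∩ X = ∅ := by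
      ext x
      simp only [mem_inter_iff, mem_preimage, mem_compl_iff, mem_empty_iff_false, iff_false,
        not_and]
      exact fun h1 h2 => h1 (hhf.mapsTo h2)
    rw [this]
    simp
  have hμY : μ.restrict Y = μ := Measure.restrict_eq_self_of_ae_mem (by
    rw [ae_iff]; exact hYc)
  rw [← hμY]
  choose! ρ hρ hρY hρe using hloc
  obtain ⟨t, htY, htc, htU⟩ := TopologicalSpace.countable_cover_nhdsWithin
    (f := fun y => ball y (ρ y)) (s := Y) fun y hy => mem_nhdsWithin_of_mem_nhds
      (ball_mem_nhds y (hρ y hy))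
  have hYe : Y = ⋃ y ∈ t, ball y (ρ y) :=
    Subset.antisymm htU (iUnion₂_subset fun y hy => hρY y (htY hy))
  rw [hYe]
  exact (Measure.restrict_biUnion_congr htc).2 fun y hy => hρe y (htY hy)

theorem meas_det {Dh : Euc n → Matrix (Fin n) (Fin n) ℝ}
    (hm : ∀ i j, Measurable fun x => Dh x i j) : Measurable fun x => (Dh x).det :=
  measurable_hom (B := fun x => Dh x) cont_det_of hm

theorem meas_adj {Dh : Euc n → Matrix (Fin n) (Fin n) ℝ}
    (hm : ∀ i j, Measurable fun x => Dh x i j) (i j : Fin n) :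
    Measurable fun x => (Dh x).adjugate i j :=
  measurable_hom (B := fun x => Dh x) (cont_adj_of i j) hm

theorem lintegral_cv (hn : 2 ≤ n) {X Y : Set (Euc n)} (hX : IsOpen X) (hY : IsOpen Y)
    {h f : Euc n → Euc n} (hhf : IsHomeoOn h f X Y) (hmh : Measurable h)
    {Dh : Euc n → Matrix (Fin n) (Fin n) ℝ} (hS : MemSobolev (n : ℝ) X h Dh)
    (hm : ∀ i j, Measurable fun x => Dh x i j)
    (hJ : ∀ᵐ x ∂(volume.restrict X), 0 ≤ (Dh x).det)
    {g : Euc n → ℝ≥0∞} (hg : Measurable g) :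
    ∫⁻ x in X, g (h x) * ENNReal.ofReal (Dh x).det = ∫⁻ y in Y, g y := by
  have hgh : Measurable fun x => g (h x) := hg.comp hmh
  rw [← change_var hn hX hY hhf hmh hS hm hJ, lintegral_map hg hmh,
    lintegral_withDensity_eq_lintegral_mul _ (meas_det hm).ennreal_ofReal hgh]
  refine lintegral_congr fun x => ?_
  simp [mul_comm]

theorem integrable_cv (hn : 2 ≤ n) {X Y : Set (Euc n)} (hX : IsOpen X) (hY : IsOpen Y)
    {h f : Euc n → Euc n} (hhf : IsHomeoOn h f X Y) (hmh : Measurable h)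
    {Dh : Euc n → Matrix (Fin n) (Fin n) ℝ} (hS : MemSobolev (n : ℝ) X h Dh)
    (hm : ∀ i j, Measurable fun x => Dh x i j)
    (hJ : ∀ᵐ x ∂(volume.restrict X), 0 ≤ (Dh x).det)
    {g : Euc n → ℝ} (hg : AEStronglyMeasurable g (volume.restrict Y)) :
    IntegrableOn (fun x => g (h x) * (Dh x).det) X ↔ IntegrableOn g Y := by
  have e := change_var hn hX hY hhf hmh hS hm hJ
  rw [← e] at hg
  rw [IntegrableOn, IntegrableOn, ← e]
  rw [integrable_map_measure hg hmh.aemeasurable,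
    integrable_withDensity_iff_integrable_smul' (meas_det hm).ennreal_ofReal
    (Eventually.of_forall fun x => ENNReal.ofReal_lt_top)]
  refine integrable_congr ?_
  filter_upwards [hJ] with x hx
  simp [ENNReal.toReal_ofReal hx, mul_comm]

theorem integral_cv (hn : 2 ≤ n) {X Y : Set (Euc n)} (hX : IsOpen X) (hY : IsOpen Y)
    {h f : Euc n → Euc n} (hhf : IsHomeoOn h f X Y) (hmh : Measurable h)
    {Dh : Euc n → Matrix (Fin n) (Fin n) ℝ} (hS : MemSobolev (n : ℝ) X h Dh)
    (hm : ∀ i j, Measurable fun x => Dh x i j)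
    (hJ : ∀ᵐ x ∂(volume.restrict X), 0 ≤ (Dh x).det)
    {g : Euc n → ℝ} (hg : AEStronglyMeasurable g (volume.restrict Y)) :
    ∫ x in X, g (h x) * (Dh x).det = ∫ y in Y, g y := by
  have e := change_var hn hX hY hhf hmh hS hm hJ
  rw [← e] at hg
  rw [← e]
  rw [integral_map hmh.aemeasurable hg,
    integral_withDensity_eq_integral_toReal_smul (meas_det hm).ennreal_ofReal
    (Eventually.of_forall fun x => ENNReal.ofReal_lt_top)]
  refine integral_congr_ae ?_
  filter_upwards [hJ] with x hx
  simp [ENNReal.toReal_ofReal hx, mul_comm]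

end

section
open Filter Topology
variable {n : ℕ}

theorem image_compact {X Y : Set (Euc n)} {h f : Euc n → Euc n} (hhf : IsHomeoOn h f X Y)
    {T : Set (Euc n)} (hT : IsCompact T) (hTY : T ⊆ Y) :
    IsCompact (f '' T) ∧ f '' T ⊆ X ∧ ∀ x ∈ X, h x ∈ T → x ∈ f '' T := by
  refine ⟨hT.image_of_continuousOn (hhf.continuousOn_inv.mono hTY), ?_, fun x hx hxT => ?_⟩
  · rintro _ ⟨y, hy, rfl⟩
    exact hhf.mapsTo_inv (hTY hy)
  · exact ⟨h x, hxT, hhf.left_inv x hx⟩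

/-- integrability of `φ ∘ h * w` -/
theorem integrable_comp_mul {X Y : Set (Euc n)} (hX : IsOpen X) {h f : Euc n → Euc n}
    (hhf : IsHomeoOn h f X Y) {φ : Euc n → ℝ} (hφ : Continuous φ) (hφc : HasCompactSupport φ)
    (hφY : tsupport φ ⊆ Y) {w : Euc n → ℝ}
    (hw : ∀ K, IsCompact K → K ⊆ X → IntegrableOn w K) :
    IntegrableOn (fun x => φ (h x) * w x) X := by
  obtain ⟨k1, k2, k3⟩ := image_compact hhf hφc.isCompact hφY
  set K := f '' tsupport φ
  obtain ⟨G, hG⟩ := hφc.exists_bound_of_continuous hφ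
  have hcont : ContinuousOn (fun x => φ (h x)) X := hφ.comp_continuousOn hhf.continuousOn
  rw [← sdiff_union_of_subset k2]
  refine IntegrableOn.union ?_ ?_
  · refine integrableOn_zero.congr_fun (fun x hx => ?_) (hX.measurableSet.diff k1.measurableSet)
    have : h x ∉ tsupport φ := fun hc => hx.2 (k3 x hx.1 hc)
    simp [image_eq_zero_of_notMem_tsupport this]
  · refine Integrable.bdd_mul (c := G) (hw K k1 k2) ?_ ?_
    · exact (hcont.mono k2).aestronglyMeasurable k1.measurableSet
    · exact Eventually.of_forall fun x => hG _

theorem coord_contDiff (i : Fin n) : ContDiff ℝ (⊤ : ℕ∞) fun x : Euc n => x i := by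
  fun_prop

theorem coord_fderiv (i k : Fin n) (x : Euc n) :
    fderiv ℝ (fun x : Euc n => x i) x (EuclideanSpace.single k 1) = if k = i then 1 else 0 := by
  have : (fun x : Euc n => x i) = (EuclideanSpace.proj i : Euc n →L[ℝ] ℝ) := by
    ext x; simp
  rw [this, ContinuousLinearMap.fderiv]
  simp [Pi.single_apply, eq_comm]

theorem abs_coord_le (x : Euc n) (i : Fin n) : |x i| ≤ ‖x‖ := by
  simpa using PiLp.norm_apply_le x i

theorem fderiv_hasCompactSupport_apply {φ : Euc n → ℝ} (hφc : HasCompactSupport φ) (v : Euc n) :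
    tsupport (fun y => fderiv ℝ φ y v) ⊆ tsupport φ := by
  refine closure_minimal (fun y hy => ?_) (isClosed_tsupport φ)
  by_contra hc
  refine hy ?_
  have : y ∉ tsupport (fderiv ℝ φ) := fun h => hc (tsupport_fderiv_subset ℝ h)
  simp [image_eq_zero_of_notMem_tsupport this]

theorem cofactor_parts (hn : 2 ≤ n) {X Y : Set (Euc n)} (hX : IsOpen X) (hY : IsOpen Y)
    {h f : Euc n → Euc n} (hhf : IsHomeoOn h f X Y)
    {Dh : Euc n → Matrix (Fin n) (Fin n) ℝ} (hS : MemSobolev (n : ℝ) X h Dh)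
    (hm : ∀ i j, Measurable fun x => Dh x i j)
    {φ : Euc n → ℝ} (hφ : ContDiff ℝ (⊤ : ℕ∞) φ) (hφc : HasCompactSupport φ)
    (hφY : tsupport φ ⊆ Y) (i j : Fin n) :
    ∫ x in X, φ (h x) * (Dh x).adjugate i j =
      - ∫ x in X, x i * fderiv ℝ φ (h x) (EuclideanSpace.single j 1) * (Dh x).det := by
  set ψ : Euc n → ℝ := fun y => fderiv ℝ φ y (EuclideanSpace.single j 1) with hψ
  have hψcont : Continuous ψ := (hφ.continuous_fderiv (by simp)).clm_apply continuous_const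
  have hψs : tsupport ψ ⊆ tsupport φ := fderiv_hasCompactSupport_apply hφc _
  have hψc : HasCompactSupport ψ := hφc.isCompact.of_isClosed_subset (isClosed_tsupport _) hψs
  obtain ⟨V, hV, hφV, hVY, hVc⟩ := exists_open_between_and_isCompact_closure hφc.isCompact hY hφY
  obtain ⟨k1, k2, k3⟩ := image_compact hhf hVc hVY
  set K := f '' closure V with hKdef
  set O := X ∩ h ⁻¹' V with hOdef
  have hO : IsOpen O := hhf.continuousOn.isOpen_inter_preimage hX hV
  have hOK : O ⊆ K := fun x hx => k3 x hx.1 (subset_closure (mem_preimage.1 hx.2))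
  have hOX : O ⊆ X := inter_subset_left
  have hclO : closure O ⊆ K := closure_minimal hOK k1.isClosed
  have hfrO : ∀ x ∈ frontier O, x ∈ K ∧ h x ∉ V := by
    intro x hx
    rw [hO.frontier_eq] at hx
    have hxK := hclO hx.1
    exact ⟨hxK, fun hc => hx.2 ⟨k2 hxK, mem_preimage.2 hc⟩⟩
  obtain ⟨ε, hε, hεV⟩ := hφc.isCompact.exists_thickening_subset_open hV hφV
  obtain ⟨H, hH, hu, hdet, hadj⟩ := approx hn hX hhf.continuousOn hS hm k1 k2
  have hφuc : UniformContinuous φ := hφc.uniformContinuous_of_continuous hφ.continuous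
  have hψuc : UniformContinuous ψ := hψc.uniformContinuous_of_continuous hψcont
  obtain ⟨G, hG⟩ := hφc.exists_bound_of_continuous hφ.continuous
  obtain ⟨G', hG'⟩ := hψc.exists_bound_of_continuous hψcont
  obtain ⟨R, hR⟩ := k1.isBounded.exists_norm_le
  have hadjc : ∀ k, Continuous fun x => (jac (H k) x).adjugate i j := fun k =>
    (contDiff_adjugate (jac_entry_contDiff (hH k)) i j).continuous
  have lim1 : Tendsto (fun k => ∫ x in O, φ (H k x) * (jac (H k) x).adjugate i j) atTop
      (𝓝 (∫ x in O, φ (h x) * (Dh x).adjugate i j)) := by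
    refine tendsto_int_mul hO.measurableSet ((adj_integrableOn hn hS hm k1 k2 i j).mono_set hOK)
      ?_ ?_ ?_ ?_ (G := G) ?_
    · exact fun k => ((hadjc k).continuousOn.integrableOn_compact k1).mono_set hOK
    · exact tendsto_of_tendsto_of_tendsto_of_le_of_le tendsto_const_nhds (hadj i j)
        (fun k => zero_le) fun k => lintegral_mono_set hOK
    · exact fun k => (hφ.continuous.comp (hH k).continuous).aestronglyMeasurable
    · exact hφuc.comp_tendstoUniformlyOn (hu.mono hOK)
    · exact fun x _ => hG _
  have hcoordc : Continuous fun x : Euc n => x i := (coord_contDiff i).continuous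
  have lim2 : Tendsto (fun k => ∫ x in O, (x i * ψ (H k x)) * (jac (H k) x).det) atTop
      (𝓝 (∫ x in O, (x i * ψ (h x)) * (Dh x).det)) := by
    refine tendsto_int_mul hO.measurableSet ((det_integrableOn hn hS hm k1 k2).mono_set hOK)
      ?_ ?_ ?_ ?_ (G := R * G') ?_
    · exact fun k => ((jac_det_continuous (hH k)).continuousOn.integrableOn_compact k1).mono_set hOK
    · exact tendsto_of_tendsto_of_tendsto_of_le_of_le tendsto_const_nhds hdet
        (fun k => zero_le) fun k => lintegral_mono_set hOK
    · exact fun k => (hcoordc.mul (hψcont.comp (hH k).continuous)).aestronglyMeasurable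
    · have h1 := hψuc.comp_tendstoUniformlyOn (hu.mono hOK)
      rw [Metric.tendstoUniformlyOn_iff] at h1 ⊢
      intro ε hε
      filter_upwards [h1 (ε / (|R| + 1)) (by positivity)] with k hk x hx
      have h2 := hk x hx
      rw [Real.dist_eq] at h2 ⊢
      simp only [Function.comp] at h2
      rw [← mul_sub, abs_mul]
      have h3 : |x i| ≤ |R| := (abs_coord_le x i).trans ((hR x (hOK hx)).trans (le_abs_self R))
      have h4 : (|R| + 1) * (ε / (|R| + 1)) = ε := by field_simp
      calc |x i| * |ψ (h x) - ψ (H k x)| ≤ |R| * (ε / (|R| + 1)) := by gcongr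
        _ < (|R| + 1) * (ε / (|R| + 1)) := by
          have : 0 < ε / (|R| + 1) := by positivity
          linarith
        _ = ε := h4
    · intro x hx
      rw [abs_mul]
      have h3 : |x i| ≤ R := (abs_coord_le x i).trans (hR x (hOK hx))
      exact mul_le_mul h3 (hG' _) (abs_nonneg _) ((abs_nonneg _).trans h3)
  have hev : ∀ᶠ k in atTop, (∫ x in O, φ (H k x) * (jac (H k) x).adjugate i j) +
      ∫ x in O, (x i * ψ (H k x)) * (jac (H k) x).det = 0 := by
    filter_upwards [Metric.tendstoUniformlyOn_iff.1 hu ε hε] with k hk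
    have h1 := parts_smooth (hH k) hO (k1.isBounded.subset hOK) hφ (fun x hx hc => by
      obtain ⟨hxK, hxV⟩ := hfrO x hx
      exact hxV (hεV (mem_thickening_iff.2 ⟨H k x, hc, hk x hxK⟩))) (coord_contDiff i) j
    simp only [coord_fderiv, ite_mul, one_mul, zero_mul, Finset.sum_ite_eq', Finset.mem_univ,
      if_true] at h1
    rw [← integral_add]
    · exact h1
    · have c1 : Continuous fun x => φ (H k x) * (jac (H k) x).adjugate i j :=
        (hφ.continuous.comp (hH k).continuous).mul (hadjc k)
      exact (c1.continuousOn.integrableOn_compact k1).mono_set hOK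
    · have c1 : Continuous fun x => (x i * ψ (H k x)) * (jac (H k) x).det :=
        (hcoordc.mul (hψcont.comp (hH k).continuous)).mul (jac_det_continuous (hH k))
      exact (c1.continuousOn.integrableOn_compact k1).mono_set hOK
  have hsum := tendsto_nhds_unique (lim1.add lim2) (tendsto_const_nhds.congr'
      (hev.mono fun k hk => hk.symm))
  have hout : ∀ x ∈ X, x ∉ O → h x ∉ tsupport φ := fun x hx hxO hc =>
    hxO ⟨hx, mem_preimage.2 (hφV hc)⟩
  have e1 : ∫ x in X, φ (h x) * (Dh x).adjugate i j = ∫ x in O, φ (h x) * (Dh x).adjugate i j :=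
    setIntegral_eq_of_subset_of_forall_sdiff_eq_zero hX.measurableSet hOX fun x hx => by
      rw [image_eq_zero_of_notMem_tsupport (hout x hx.1 hx.2), zero_mul]
  have e2 : ∫ x in X, x i * ψ (h x) * (Dh x).det = ∫ x in O, x i * ψ (h x) * (Dh x).det :=
    setIntegral_eq_of_subset_of_forall_sdiff_eq_zero hX.measurableSet hOX fun x hx => by
      rw [image_eq_zero_of_notMem_tsupport (fun hc => hout x hx.1 hx.2 (hψs hc)), mul_zero, zero_mul]
  rw [e1, e2]
  linarith

end

section
open Filter Topology
variable {n : ℕ}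

theorem opNorm_nonneg (M : Matrix (Fin n) (Fin n) ℝ) : 0 ≤ opNorm M := norm_nonneg _

theorem opNorm_smul (c : ℝ) (M : Matrix (Fin n) (Fin n) ℝ) : opNorm (c • M) = |c| * opNorm M := by
  unfold opNorm
  rw [map_smul, map_smul, norm_smul, Real.norm_eq_abs]

theorem opNorm_continuous :
    Continuous fun a : Fin n → Fin n → ℝ => opNorm (Matrix.of a) := by
  unfold opNorm
  refine continuous_norm.comp ?_
  let L : (Fin n → Fin n → ℝ) →ₗ[ℝ] (Euc n →L[ℝ] Euc n) :=
    { toFun := fun a => LinearMap.toContinuousLinearMap (Matrix.toEuclideanLin (Matrix.of a))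
      map_add' := fun a b => by
        rw [← map_add, ← map_add]; rfl
      map_smul' := fun c a => by
        rw [RingHom.id_apply, ← map_smul, ← map_smul]; rfl }
  exact L.continuous_of_finiteDimensional

theorem opNorm_measurable {Dh : Euc n → Matrix (Fin n) (Fin n) ℝ}
    (hm : ∀ i j, Measurable fun x => Dh x i j) : Measurable fun x => opNorm (Dh x) :=
  measurable_hom (B := fun x => Dh x) opNorm_continuous hm

theorem homeo_symm {X Y : Set (Euc n)} {h f : Euc n → Euc n} (hhf : IsHomeoOn h f X Y) :
    IsHomeoOn f h Y X :=
  ⟨hhf.mapsTo_inv, hhf.mapsTo, hhf.right_inv, hhf.left_inv, hhf.continuousOn_inv, hhf.continuousOn⟩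

theorem distortion_formula (hn : 2 ≤ n) {A : Matrix (Fin n) (Fin n) ℝ} {J : ℝ} (hJ : 0 < J) :
    opNorm (J⁻¹ • A) ^ n * J = opNorm A ^ n / J ^ (n - 1) := by
  rw [opNorm_smul, abs_of_pos (inv_pos.2 hJ), mul_pow, inv_pow]
  have : J ^ n = J ^ (n - 1) * J := by rw [← pow_succ]; congr 1; omega
  rw [this]
  field_simp

theorem parts_cv (hn : 2 ≤ n) {X Y : Set (Euc n)} (hX : IsOpen X) (hY : IsOpen Y)
    {h f : Euc n → Euc n} (hhf : IsHomeoOn h f X Y) (hmh : Measurable h)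
    {Dh : Euc n → Matrix (Fin n) (Fin n) ℝ} (hS : MemSobolev (n : ℝ) X h Dh)
    (hm : ∀ i j, Measurable fun x => Dh x i j)
    (hJ : ∀ᵐ x ∂(volume.restrict X), 0 ≤ (Dh x).det)
    {φ : Euc n → ℝ} (hφ : ContDiff ℝ (⊤ : ℕ∞) φ) (hφc : HasCompactSupport φ)
    (hφY : tsupport φ ⊆ Y) (i j : Fin n) :
    ∫ y in Y, f y i * fderiv ℝ φ y (EuclideanSpace.single j 1) =
      - ∫ x in X, φ (h x) * (Dh x).adjugate i j := by
  rw [cofactor_parts hn hX hY hhf hS hm hφ hφc hφY i j, neg_neg]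
  have hψcont : Continuous fun y => fderiv ℝ φ y (EuclideanSpace.single j 1) :=
    (hφ.continuous_fderiv (by simp)).clm_apply continuous_const
  have hc : ContinuousOn (fun y => f y i * fderiv ℝ φ y (EuclideanSpace.single j 1)) Y :=
    ((coord_contDiff i).continuous.comp_continuousOn hhf.continuousOn_inv).mul hψcont.continuousOn
  rw [← integral_cv hn hX hY hhf hmh hS hm hJ (hc.aestronglyMeasurable hY.measurableSet)]
  refine setIntegral_congr_fun hX.measurableSet fun x hx => ?_
  simp only [hhf.left_inv x hx]

theorem part_one (hn : 2 ≤ n) {X Y : Set (Euc n)} (hX : IsOpen X) (hY : IsOpen Y)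
    {h f : Euc n → Euc n} (hhf : IsHomeoOn h f X Y) (hmh : Measurable h) (hmf : Measurable f)
    {Dh : Euc n → Matrix (Fin n) (Fin n) ℝ} (hS : MemSobolev (n : ℝ) X h Dh)
    (hm : ∀ i j, Measurable fun x => Dh x i j)
    (hJ : ∀ᵐ x ∂(volume.restrict X), 0 ≤ (Dh x).det)
    (hmK : Measurable (innerDistortion Dh))
    (hK : (∫⁻ x in X, innerDistortion Dh x) < ⊤) :
    ∃ Df, MemSobolev (n : ℝ) Y f Df := by
  set Df : Euc n → Matrix (Fin n) (Fin n) ℝ := fun y =>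
    ((Dh (f y)).det)⁻¹ • (Dh (f y)).adjugate with hDf
  have hDm : ∀ i j, Measurable fun y => Df y i j := fun i j =>
    (((meas_det hm).comp hmf).inv).mul ((meas_adj hm i j).comp hmf)
  have hadj0 : ∀ᵐ x ∂(volume.restrict X), 0 ≤ (Dh x).det ∧
      ((Dh x).det = 0 → (Dh x).adjugate = 0) := by
    filter_upwards [hJ, ae_lt_top hmK hK.ne] with x hx hxK
    refine ⟨hx, fun h0 => ?_⟩
    by_contra hc
    rw [innerDistortion, if_neg (by rw [h0]; exact lt_irrefl _), if_neg hc] at hxK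
    exact lt_irrefl _ hxK
  have hlp : IntegrableOn (fun y => opNorm (Df y) ^ n) Y := by
    refine ⟨((opNorm_measurable hDm).pow_const n).aestronglyMeasurable, ?_⟩
    have e1 : ∀ y, ‖opNorm (Df y) ^ n‖ₑ = ENNReal.ofReal (opNorm (Df y) ^ n) := fun y =>
      Real.enorm_of_nonneg (pow_nonneg (opNorm_nonneg _) _)
    unfold HasFiniteIntegral
    simp_rw [e1]
    rw [← lintegral_cv hn hX hY hhf hmh hS hm hJ
      ((opNorm_measurable hDm).pow_const n).ennreal_ofReal]
    refine lt_of_le_of_lt (lintegral_mono_ae ?_) hK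
    filter_upwards [hadj0, ae_restrict_mem hX.measurableSet] with x hx hxX
    rcases hx.1.eq_or_lt with h0 | h0
    · simp [← h0]
    · rw [innerDistortion, if_pos h0, ← ENNReal.ofReal_mul (pow_nonneg (opNorm_nonneg _) _), hDf]
      dsimp only
      rw [hhf.left_inv x hxX, distortion_formula hn h0]
  refine ⟨Df, ?_, ?_, ?_, ?_⟩
  · exact fun i => ((coord_contDiff i).continuous.comp_continuousOn
      hhf.continuousOn_inv).locallyIntegrableOn hY.measurableSet
  · intro i j
    rw [locallyIntegrableOn_iff hY.isLocallyClosed]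
    intro K hKY hKc
    have hfin : IsFiniteMeasure (volume.restrict K) := ⟨by simpa using hKc.measure_lt_top⟩
    refine Integrable.mono' ((integrable_const (1:ℝ)).add (hlp.mono_set hKY))
      (hDm i j).aestronglyMeasurable (Eventually.of_forall fun y => ?_)
    refine (entry_le_opNorm _ i j).trans ?_
    simp only [Pi.add_apply]
    rcases le_total (opNorm (Df y)) 1 with h1 | h1
    · linarith [pow_nonneg (opNorm_nonneg (Df y)) n]
    · linarith [le_self_pow₀ h1 (by omega : n ≠ 0)]
  · intro φ hφ hφc hφY i j
    rw [parts_cv hn hX hY hhf hmh hS hm hJ hφ hφc hφY i j]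
    rw [← integral_cv hn hX hY hhf hmh hS hm hJ (g := fun y => Df y i j * φ y)
      ((hDm i j).mul hφ.continuous.measurable).aestronglyMeasurable]
    congr 1
    refine integral_congr_ae ?_
    filter_upwards [hadj0, ae_restrict_mem hX.measurableSet] with x hx hxX
    simp only [hDf, hhf.left_inv x hxX, Matrix.smul_apply, smul_eq_mul]
    by_cases h0 : (Dh x).det = 0
    · simp [h0, hx.2 h0]
    · field_simp
  · simp_rw [Real.rpow_natCast]
    exact hlp

theorem ae_zero_of_compact {X : Set (Euc n)} (hX : IsOpen X) {u : Euc n → ℝ}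
    (hu : ∀ K, IsCompact K → K ⊆ X → IntegrableOn u K)
    (h0 : ∀ K, IsCompact K → K ⊆ X → ∫ x in K, u x = 0) :
    ∀ᵐ x ∂(volume.restrict X), u x = 0 := by
  have hloc : ∀ x ∈ X, ∃ r > 0, closedBall x r ⊆ X := fun x hx => by
    obtain ⟨r, hr, h1⟩ := Metric.isOpen_iff.1 hX x hx
    exact ⟨r / 2, by positivity, (closedBall_subset_ball (by linarith)).trans h1⟩
  choose! r hr hrX using hloc
  obtain ⟨t, htX, htc, htU⟩ := TopologicalSpace.countable_cover_nhdsWithin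
    (f := fun y => closedBall y (r y)) (s := X) fun y hy => mem_nhdsWithin_of_mem_nhds
      (closedBall_mem_nhds y (hr y hy))
  have h1 : ∀ᵐ x ∂(volume.restrict (⋃ y ∈ t, closedBall y (r y))), u x = 0 := by
    rw [ae_restrict_biUnion_iff _ htc]
    intro y hy
    refine ae_eq_zero_of_forall_setIntegral_isClosed_eq_zero
      (hu _ (isCompact_closedBall _ _) (hrX y (htX hy))) fun s hs => ?_
    rw [Measure.restrict_restrict hs.measurableSet]
    exact h0 _ ((isCompact_closedBall _ _).inter_left hs)
      (inter_subset_right.trans (hrX y (htX hy)))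
  exact ae_mono (Measure.restrict_mono htU le_rfl) h1

theorem ae_zero_of_test {X Y : Set (Euc n)} (hX : IsOpen X) (hY : IsOpen Y)
    {h f : Euc n → Euc n} (hhf : IsHomeoOn h f X Y) {u : Euc n → ℝ}
    (hu : ∀ K, IsCompact K → K ⊆ X → IntegrableOn u K)
    (h0 : ∀ φ : Euc n → ℝ, ContDiff ℝ (⊤ : ℕ∞) φ → HasCompactSupport φ → tsupport φ ⊆ Y →
      ∫ x in X, φ (h x) * u x = 0) :
    ∀ᵐ x ∂(volume.restrict X), u x = 0 := by
  have hop : ∀ W, IsOpen W → IsCompact (closure W) → closure W ⊆ X → ∫ x in W, u x = 0 := by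
    intro W hW hWc hWX
    have hU : IsOpen (Y ∩ f ⁻¹' W) := hhf.continuousOn_inv.isOpen_inter_preimage hY hW
    set U := Y ∩ f ⁻¹' W with hUdef
    obtain ⟨c1, c2, c3⟩ := image_compact (homeo_symm hhf) hWc hWX
    obtain ⟨g, g1, g2, g3, g4, g5⟩ := smooth_exhaust hU
    have hsup : ∀ k, tsupport (g k) ⊆ h '' closure W := fun k =>
      closure_minimal (fun y hy => by
        by_contra hc
        refine hy (g3 k y fun hyU => hc (c3 y hyU.1 (subset_closure (mem_preimage.1 hyU.2)))))
        c1.isClosed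
    have hmem : ∀ x ∈ X, (h x ∈ U ↔ x ∈ W) := fun x hx =>
      ⟨fun hxU => by have := mem_preimage.1 hxU.2; rwa [hhf.left_inv x hx] at this,
        fun hxW => ⟨hhf.mapsTo hx, mem_preimage.2 (by rwa [hhf.left_inv x hx])⟩⟩
    have hWX' : W ⊆ X := subset_closure.trans hWX
    have hz : ∀ k, ∫ x in W, g k (h x) * u x = 0 := by
      intro k
      rw [← h0 (g k) (g1 k) (c1.of_isClosed_subset (isClosed_tsupport _) (hsup k))
        ((hsup k).trans c2)]
      refine (setIntegral_eq_of_subset_of_forall_sdiff_eq_zero hX.measurableSet hWX' ?_).symm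
      intro x hx
      rw [g3 k (h x) fun hc => hx.2 ((hmem x hx.1).1 hc), zero_mul]
    have huW : IntegrableOn u W := (hu _ hWc hWX).mono_set subset_closure
    have hlim : Tendsto (fun k => ∫ x in W, g k (h x) * u x) atTop (𝓝 (∫ x in W, u x)) := by
      refine tendsto_integral_of_dominated_convergence (fun x => |u x|) ?_ huW.abs ?_ ?_
      · exact fun k => (((g1 k).continuous.comp_continuousOn hhf.continuousOn).mono
          hWX').aestronglyMeasurable hW.measurableSet |>.mul huW.aestronglyMeasurable
      · refine fun k => Eventually.of_forall fun x => ?_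
        rw [norm_mul, Real.norm_eq_abs, Real.norm_eq_abs, abs_of_nonneg (g2 k _).1]
        exact mul_le_of_le_one_left (abs_nonneg _) (g2 k _).2
      · refine (ae_restrict_iff' hW.measurableSet).2 (Eventually.of_forall fun x hx => ?_)
        have h2 := g5 (h x)
        rw [indicator_of_mem ((hmem x (hWX' hx)).2 hx)] at h2
        simpa using h2.mul_const (u x)
    simp_rw [hz] at hlim
    exact tendsto_nhds_unique hlim tendsto_const_nhds
  refine ae_zero_of_compact hX hu fun K hK hKX => ?_
  obtain ⟨W, hW, hKW, hWX, hWc⟩ := exists_open_between_and_isCompact_closure hK hX hKX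
  have a1 := hop W hW hWc hWX
  have hcl : closure (W \ K) ⊆ closure W := closure_mono sdiff_subset
  have a2 := hop (W \ K) (hW.sdiff hK.isClosed)
    (hWc.of_isClosed_subset isClosed_closure hcl) (hcl.trans hWX)
  have a3 := setIntegral_sdiff hK.measurableSet ((hu _ hWc hWX).mono_set subset_closure) hKW
  linarith

end

section
open Filter Topology
variable {n : ℕ}

theorem innerDistortion_measurable {Dh : Euc n → Matrix (Fin n) (Fin n) ℝ}
    (hm : ∀ i j, Measurable fun x => Dh x i j) : Measurable (innerDistortion Dh) := by
  unfold innerDistortion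
  have hA : Measurable fun x => opNorm (Dh x).adjugate := opNorm_measurable (meas_adj hm)
  refine Measurable.ite (measurableSet_lt measurable_const (meas_det hm)) ?_ ?_
  · exact ((hA.pow_const n).div ((meas_det hm).pow_const (n - 1))).ennreal_ofReal
  · refine Measurable.ite ?_ measurable_const measurable_const
    have : {x | (Dh x).adjugate = 0} = ⋂ i, ⋂ j, {x | (Dh x).adjugate i j = 0} := by
      ext x
      simp only [mem_ofPred_eq, mem_iInter]
      exact ⟨fun h i j => by rw [h]; rfl, fun h => by ext i j; exact h i j⟩
    rw [this]
    exact MeasurableSet.iInter fun i => MeasurableSet.iInter fun j =>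
      (meas_adj hm i j) (measurableSet_singleton 0)

theorem adj_eq (hn : 2 ≤ n) {X Y : Set (Euc n)} (hX : IsOpen X) (hY : IsOpen Y)
    {h f : Euc n → Euc n} (hhf : IsHomeoOn h f X Y) (hmh : Measurable h)
    {Dh : Euc n → Matrix (Fin n) (Fin n) ℝ} (hS : MemSobolev (n : ℝ) X h Dh)
    (hm : ∀ i j, Measurable fun x => Dh x i j)
    (hJ : ∀ᵐ x ∂(volume.restrict X), 0 ≤ (Dh x).det)
    {Df : Euc n → Matrix (Fin n) (Fin n) ℝ} (hSf : MemSobolev (n : ℝ) Y f Df)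
    (hmD : ∀ i j, Measurable fun x => Df x i j) (i j : Fin n) :
    ∀ᵐ x ∂(volume.restrict X), (Dh x).adjugate i j - Df (h x) i j * (Dh x).det = 0 := by
  have hintg : ∀ K, IsCompact K → K ⊆ X → IntegrableOn (fun x => Df (h x) i j * (Dh x).det) K := by
    intro K hK hKX
    obtain ⟨c1, c2, c3⟩ := image_compact (homeo_symm hhf) hK hKX
    have i1 : IntegrableOn (fun y => Df y i j) (h '' K) :=
      (locallyIntegrableOn_iff hY.isLocallyClosed).1 (hSf.locIntD i j) _ c2 c1
    have i2 : IntegrableOn ((h '' K).indicator fun y => Df y i j) Y :=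
      (i1.integrable_indicator c1.measurableSet).integrableOn
    rw [← integrable_cv hn hX hY hhf hmh hS hm hJ i2.aestronglyMeasurable] at i2
    refine (i2.mono_set hKX).congr_fun (fun x hx => ?_) hK.measurableSet
    dsimp only
    rw [indicator_of_mem (mem_image_of_mem h hx)]
  have hu : ∀ K, IsCompact K → K ⊆ X →
      IntegrableOn (fun x => (Dh x).adjugate i j - Df (h x) i j * (Dh x).det) K :=
    fun K hK hKX => (adj_integrableOn hn hS hm hK hKX i j).sub (hintg K hK hKX)
  refine ae_zero_of_test hX hY hhf hu fun φ hφ hφc hφY => ?_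
  have j1 := integrable_comp_mul hX hhf hφ.continuous hφc hφY
    (fun K hK hKX => adj_integrableOn hn hS hm hK hKX i j)
  have j2 := integrable_comp_mul hX hhf hφ.continuous hφc hφY hintg
  have e0 := parts_cv hn hX hY hhf hmh hS hm hJ hφ hφc hφY i j
  rw [hSf.parts φ hφ hφc hφY i j, ← integral_cv hn hX hY hhf hmh hS hm hJ
    (g := fun y => Df y i j * φ y)
    ((hmD i j).mul hφ.continuous.measurable).aestronglyMeasurable] at e0
  simp_rw [mul_sub]
  rw [integral_sub j1 j2, ← neg_inj.1 e0, sub_eq_zero]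
  refine integral_congr_ae (Eventually.of_forall fun x => ?_)
  dsimp only
  ring

theorem part_two (hn : 2 ≤ n) {X Y : Set (Euc n)} (hX : IsOpen X) (hY : IsOpen Y)
    {h f : Euc n → Euc n} (hhf : IsHomeoOn h f X Y) (hmh : Measurable h) (hmf : Measurable f)
    {Dh : Euc n → Matrix (Fin n) (Fin n) ℝ} (hS : MemSobolev (n : ℝ) X h Dh)
    (hm : ∀ i j, Measurable fun x => Dh x i j)
    (hJ : ∀ᵐ x ∂(volume.restrict X), 0 ≤ (Dh x).det)
    {Df : Euc n → Matrix (Fin n) (Fin n) ℝ} (hSf : MemSobolev (n : ℝ) Y f Df)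
    (hmD : ∀ i j, Measurable fun x => Df x i j) :
    (∫⁻ y in Y, ENNReal.ofReal (opNorm (Df y) ^ n)) = ∫⁻ x in X, innerDistortion Dh x := by
  have hadj : ∀ᵐ x ∂(volume.restrict X), (Dh x).adjugate = (Dh x).det • Df (h x) := by
    have : ∀ᵐ x ∂(volume.restrict X), ∀ i j,
        (Dh x).adjugate i j - Df (h x) i j * (Dh x).det = 0 :=
      ae_all_iff.2 fun i => ae_all_iff.2 fun j => adj_eq hn hX hY hhf hmh hS hm hJ hSf hmD i j
    filter_upwards [this] with x hx
    ext i j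
    rw [Matrix.smul_apply, smul_eq_mul, mul_comm]
    exact sub_eq_zero.1 (hx i j)
  have hdet : ∀ᵐ x ∂(volume.restrict X), 0 < (Dh x).det → 0 < (Df (h x)).det := by
    filter_upwards [hadj] with x hx h0
    have h1 := congrArg Matrix.det hx
    rw [Matrix.det_adjugate, Matrix.det_smul, Fintype.card_fin] at h1
    have h2 : 0 < (Dh x).det ^ (n - 1) := pow_pos h0 _
    rw [h1] at h2
    exact (mul_pos_iff_of_pos_left (pow_pos h0 n)).1 h2
  have hmJf := meas_det hmD
  have hJf : ∀ᵐ y ∂(volume.restrict Y), 0 ≤ (Df y).det := by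
    have hN : MeasurableSet {y | (Df y).det < 0} := measurableSet_lt hmJf measurable_const
    have h1 : (∫⁻ y in Y, ({y | (Df y).det < 0}.indicator (fun _ => (1 : ℝ≥0∞))) y) = 0 := by
      rw [← lintegral_cv hn hX hY hhf hmh hS hm hJ (measurable_const.indicator hN)]
      refine lintegral_eq_zero_of_ae_eq_zero ?_
      filter_upwards [hdet] with x hx
      rcases le_or_gt (Dh x).det 0 with h0 | h0
      · simp [ENNReal.ofReal_of_nonpos h0]
      · have : h x ∉ {y | (Df y).det < 0} := fun hc => lt_asymm (hx h0) hc
        simp [this]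
    rw [lintegral_indicator hN, setLIntegral_one, Measure.restrict_apply hN] at h1
    rw [ae_iff, Measure.restrict_apply (by simpa only [not_le] using hN)]
    simpa only [not_le] using h1
  have hpos : ∀ᵐ x ∂(volume.restrict X), 0 < (Dh x).det := by
    have hN : MeasurableSet {x | (Dh x).det = 0} := (meas_det hm) (measurableSet_singleton 0)
    have h1 : (∫⁻ x in X, ({x | (Dh x).det = 0}.indicator (fun _ => (1 : ℝ≥0∞))) x) = 0 := by
      rw [← lintegral_cv hn hY hX (homeo_symm hhf) hmf hSf hmD hJf (measurable_const.indicator hN)]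
      have hmG : Measurable fun y => {x | (Dh x).det = 0}.indicator (fun _ => (1 : ℝ≥0∞)) (f y) *
          ENNReal.ofReal (Df y).det :=
        ((measurable_const.indicator hN).comp hmf).mul hmJf.ennreal_ofReal
      rw [← lintegral_cv hn hX hY hhf hmh hS hm hJ hmG]
      refine lintegral_eq_zero_of_ae_eq_zero ?_
      filter_upwards [ae_restrict_mem hX.measurableSet] with x hxX
      rw [hhf.left_inv x hxX]
      by_cases h0 : (Dh x).det = 0
      · simp [h0]
      · simp [h0]
    rw [lintegral_indicator hN, setLIntegral_one, Measure.restrict_apply hN] at h1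
    have h2 : ∀ᵐ x ∂(volume.restrict X), (Dh x).det ≠ 0 := by
      rw [ae_iff, Measure.restrict_apply (by simpa only [not_not] using hN)]
      simpa only [not_not] using h1
    filter_upwards [h2, hJ] with x hx hx0
    exact lt_of_le_of_ne hx0 hx.symm
  rw [← lintegral_cv hn hX hY hhf hmh hS hm hJ
    ((opNorm_measurable hmD).pow_const n).ennreal_ofReal]
  refine lintegral_congr_ae ?_
  filter_upwards [hadj, hpos] with x hx h0
  have h1 : Df (h x) = ((Dh x).det)⁻¹ • (Dh x).adjugate := by
    rw [hx, smul_smul, inv_mul_cancel₀ h0.ne', one_smul]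
  rw [innerDistortion, if_pos h0, ← ENNReal.ofReal_mul (pow_nonneg (opNorm_nonneg _) _), h1,
    distortion_formula hn h0]

theorem sobolev_congr {X : Set (Euc n)} (hX : IsOpen X) {g g' : Euc n → Euc n}
    {D D' : Euc n → Matrix (Fin n) (Fin n) ℝ} (hg : ∀ x ∈ X, g x = g' x)
    (hD : ∀ᵐ x ∂(volume.restrict X), D x = D' x) {p : ℝ} (hS : MemSobolev p X g D) :
    MemSobolev p X g' D' := by
  refine ⟨fun i => ?_, fun i j => ?_, fun φ hφ hφc hφX i j => ?_, ?_⟩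
  · rw [locallyIntegrableOn_iff hX.isLocallyClosed]
    intro K hKX hK
    refine ((locallyIntegrableOn_iff hX.isLocallyClosed).1 (hS.locInt i) K hKX hK).congr_fun
      (fun x hx => ?_) hK.measurableSet
    dsimp only
    rw [hg x (hKX hx)]
  · rw [locallyIntegrableOn_iff hX.isLocallyClosed]
    intro K hKX hK
    refine Integrable.congr
      ((locallyIntegrableOn_iff hX.isLocallyClosed).1 (hS.locIntD i j) K hKX hK) ?_
    filter_upwards [ae_mono (Measure.restrict_mono hKX le_rfl) hD] with x hx
    rw [hx]
  · have h1 := hS.parts φ hφ hφc hφX i j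
    have e1 : ∫ x in X, g x i * fderiv ℝ φ x (EuclideanSpace.single j 1) =
        ∫ x in X, g' x i * fderiv ℝ φ x (EuclideanSpace.single j 1) :=
      setIntegral_congr_fun hX.measurableSet fun x hx => by
        dsimp only
        rw [hg x hx]
    have e2 : ∫ x in X, D x i j * φ x = ∫ x in X, D' x i j * φ x :=
      integral_congr_ae (by filter_upwards [hD] with x hx; rw [hx])
    rw [← e1, ← e2, h1]
  · exact Integrable.congr hS.lp (by filter_upwards [hD] with x hx; rw [hx])

theorem measurable_version {X : Set (Euc n)} {g : Euc n → Euc n}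
    {D : Euc n → Matrix (Fin n) (Fin n) ℝ} {p : ℝ} (hS : MemSobolev p X g D) :
    ∃ D' : Euc n → Matrix (Fin n) (Fin n) ℝ, (∀ i j, Measurable fun x => D' x i j) ∧
      ∀ᵐ x ∂(volume.restrict X), D x = D' x := by
  have ha : ∀ i j, AEStronglyMeasurable (fun x => D x i j) (volume.restrict X) := fun i j =>
    (hS.locIntD i j).aestronglyMeasurable
  refine ⟨fun x => Matrix.of fun i j => (ha i j).mk _ x, fun i j =>
    (ha i j).stronglyMeasurable_mk.measurable, ?_⟩
  have : ∀ᵐ x ∂(volume.restrict X), ∀ i j, D x i j = (ha i j).mk _ x :=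
    ae_all_iff.2 fun i => ae_all_iff.2 fun j => (ha i j).ae_eq_mk
  filter_upwards [this] with x hx
  ext i j
  exact hx i j

theorem measurable_map_version {X : Set (Euc n)} (hX : IsOpen X) {g : Euc n → Euc n}
    (hg : ContinuousOn g X) : ∃ g' : Euc n → Euc n, Measurable g' ∧ ∀ x ∈ X, g x = g' x := by
  classical
  refine ⟨X.piecewise g (fun _ => 0), hg.measurable_piecewise continuousOn_const hX.measurableSet,
    fun x hx => ?_⟩
  rw [piecewise_eq_of_mem _ _ _ hx]

theorem innerDistortion_congr {X : Set (Euc n)} {D D' : Euc n → Matrix (Fin n) (Fin n) ℝ}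
    (hD : ∀ᵐ x ∂(volume.restrict X), D x = D' x) :
    ∫⁻ x in X, innerDistortion D x = ∫⁻ x in X, innerDistortion D' x := by
  refine lintegral_congr_ae ?_
  filter_upwards [hD] with x hx
  unfold innerDistortion
  rw [hx]

theorem main_aux (hn : 2 ≤ n) (X Y : Set (Euc n)) (hX : IsOpen X) (hY : IsOpen Y)
    (h f : Euc n → Euc n) (hhf : IsHomeoOn h f X Y)
    (Dh : Euc n → Matrix (Fin n) (Fin n) ℝ) (hS : MemSobolev (n : ℝ) X h Dh)
    (hJ : ∀ᵐ x ∂(volume.restrict X), 0 ≤ (Dh x).det) :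
    ((∫⁻ x in X, innerDistortion Dh x) < ⊤ ↔ ∃ Df, MemSobolev (n : ℝ) Y f Df) ∧
      ∀ Df, MemSobolev (n : ℝ) Y f Df →
        (∫⁻ y in Y, ENNReal.ofReal (opNorm (Df y) ^ n)) = ∫⁻ x in X, innerDistortion Dh x := by
  obtain ⟨Dh', hm, hDh⟩ := measurable_version hS
  obtain ⟨h', hmh, hh⟩ := measurable_map_version hX hhf.continuousOn
  obtain ⟨f', hmf, hf⟩ := measurable_map_version hY hhf.continuousOn_inv
  have hhf' : IsHomeoOn h' f' X Y :=
    ⟨fun x hx => hh x hx ▸ hhf.mapsTo hx, fun y hy => hf y hy ▸ hhf.mapsTo_inv hy,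
      fun x hx => by rw [← hh x hx, ← hf _ (hhf.mapsTo hx), hhf.left_inv x hx],
      fun y hy => by rw [← hf y hy, ← hh _ (hhf.mapsTo_inv hy), hhf.right_inv y hy],
      hhf.continuousOn.congr fun x hx => (hh x hx).symm,
      hhf.continuousOn_inv.congr fun x hx => (hf x hx).symm⟩
  have hS' : MemSobolev (n : ℝ) X h' Dh' := sobolev_congr hX hh hDh hS
  have hJ' : ∀ᵐ x ∂(volume.restrict X), 0 ≤ (Dh' x).det := by
    filter_upwards [hJ, hDh] with x hx hx'
    rwa [← hx']
  rw [innerDistortion_congr hDh]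
  have p2 : ∀ Df, MemSobolev (n : ℝ) Y f Df →
      (∫⁻ y in Y, ENNReal.ofReal (opNorm (Df y) ^ n)) = ∫⁻ x in X, innerDistortion Dh' x := by
    intro Df hDf
    obtain ⟨Df', hmD, hDD⟩ := measurable_version hDf
    rw [← part_two hn hX hY hhf' hmh hmf hS' hm hJ' (sobolev_congr hY hf hDD hDf) hmD]
    refine lintegral_congr_ae ?_
    filter_upwards [hDD] with y hy
    rw [hy]
  refine ⟨⟨fun hK => ?_, ?_⟩, p2⟩
  · obtain ⟨Df, hDf⟩ := part_one hn hX hY hhf' hmh hmf hS' hm hJ' (innerDistortion_measurable hm) hK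
    exact ⟨Df, sobolev_congr hY (fun y hy => (hf y hy).symm) (Eventually.of_forall fun _ => rfl) hDf⟩
  · rintro ⟨Df, hDf⟩
    rw [← p2 Df hDf]
    have h1 := hDf.lp.2
    simp_rw [Real.rpow_natCast] at h1
    unfold HasFiniteIntegral at h1
    refine lt_of_le_of_lt (lintegral_mono fun y => ?_) h1
    rw [Real.enorm_of_nonneg (pow_nonneg (opNorm_nonneg _) _)]

end

/-- For an orientation-preserving homeomorphism `h : 𝕏 → 𝕐` of class
`W^{1,n}`, the inner distortion `K_I(·,h)` is integrable over `𝕏` iff `f = h⁻¹ ∈ W^{1,n}(𝕐)`,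
and in that case `∫_𝕐 |Df|ⁿ = ∫_𝕏 K_I(·,h)`. -/
theorem stmt_0 {n : ℕ} (hn : 2 ≤ n) (𝕏 𝕐 : Set (Euc n))
    (hX : IsOpen 𝕏) (hXc : IsConnected 𝕏) (hY : IsOpen 𝕐) (hYc : IsConnected 𝕐)
    (h f : Euc n → Euc n) (hhf : IsHomeoOn h f 𝕏 𝕐)
    (Dh : Euc n → Matrix (Fin n) (Fin n) ℝ)
    (hSob : MemSobolev (n : ℝ) 𝕏 h Dh)
    (hOrient : ∀ᵐ x ∂(volume.restrict 𝕏), 0 ≤ (Dh x).det) :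
    ((∫⁻ x in 𝕏, innerDistortion Dh x) < ⊤ ↔ ∃ Df, MemSobolev (n : ℝ) 𝕐 f Df) ∧
      ∀ Df : Euc n → Matrix (Fin n) (Fin n) ℝ, MemSobolev (n : ℝ) 𝕐 f Df →
        (∫⁻ y in 𝕐, ENNReal.ofReal (opNorm (Df y) ^ n)) =
          ∫⁻ x in 𝕏, innerDistortion Dh x := by
  exact main_aux hn 𝕏 𝕐 hX hY h f hhf Dh hSob hOrient
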